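/- arXiv:1812.03439 — 2 statements merged into one kernel-verified Lean document; each statement's English description precedes it below -/
import Mathlib

section
/- Let H be a quasi-Hopf algebra over a field k with bijective antipode S (inverse S̄), and let V be a left H-module. On the vector space H⊗V define h·(a⊗v) = h_(1,1) a S(h_(2)) ⊗ h_(1,2) v and δ(a⊗v) = ω1 a_(1) ω5 ⊗ (ω2 a_(2) ω4 ⊗ ω3 v) ∈ H ⊗ (H⊗V). Then: (i) the operation · makes H⊗V a left H-module; (ii) writing δ(m) = m_[-1] ⊗ m_[0] for m ∈ H⊗V, one has ε(m_[-1])·m_[0] = m; (iii) m_[-1] ⊗ (m_[0])_[-1] ⊗ (m_[0])_[0] = ω1 (m_[-1])_(1) ω5 ⊗ ω2 (m_[-1])_(2) ω4 ⊗ ω3·m_[0]; and (iv) δ(h·m) = h_(1,1) m_[-1] S(h_(2)) ⊗ h_(1,2)·m_[0] for all h ∈ H. That is, H⊗V is a Yetter–Drinfeld module of the second kind over H. -/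
open scoped TensorProduct

noncomputable section

/-- A quasi-Hopf algebra over a field `k`, presented together with explicit
(Sweedler-style) finite representations of the comultiplication and of the
associator `φ` and its inverse `φ⁻¹`.  The fields `n, d1, d2` give, for every
`h : H`, a finite family with `Δ h = ∑ i < n h, d1 h i ⊗ d2 h i`; similarly
`P1, P2, P3` (resp. `Q1, Q2, Q3`) are the components of `φ` (resp. `φ⁻¹`). -/
structure QuasiHopf (k H : Type) [Field k] [Ring H] [Algebra k H] where
  comul : H →ₐ[k] H ⊗[k] H
  counit : H →ₐ[k] k
  n : H → ℕ
  d1 : H → ℕ → H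
  d2 : H → ℕ → H
  comul_eq : ∀ h, comul h = ∑ i ∈ Finset.range (n h), d1 h i ⊗ₜ[k] d2 h i
  np : ℕ
  P1 : ℕ → H
  P2 : ℕ → H
  P3 : ℕ → H
  nq : ℕ
  Q1 : ℕ → H
  Q2 : ℕ → H
  Q3 : ℕ → H
  S : H →ₗ[k] H
  Sinv : H →ₗ[k] H
  alpha : H
  beta : H
  S_one : S 1 = 1
  S_mul : ∀ x y : H, S (x * y) = S y * S x
  Sinv_S : ∀ x : H, Sinv (S x) = x
  S_Sinv : ∀ x : H, S (Sinv x) = x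
  phi_phiInv :
    (∑ a ∈ Finset.range np, P1 a ⊗ₜ[k] (P2 a ⊗ₜ[k] P3 a)) *
      (∑ b ∈ Finset.range nq, Q1 b ⊗ₜ[k] (Q2 b ⊗ₜ[k] Q3 b)) = 1
  phiInv_phi :
    (∑ b ∈ Finset.range nq, Q1 b ⊗ₜ[k] (Q2 b ⊗ₜ[k] Q3 b)) *
      (∑ a ∈ Finset.range np, P1 a ⊗ₜ[k] (P2 a ⊗ₜ[k] P3 a)) = 1
  qcoassoc : ∀ h : H,
    ∑ i ∈ Finset.range (n h), d1 h i ⊗ₜ[k] comul (d2 h i) =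
      (∑ a ∈ Finset.range np, P1 a ⊗ₜ[k] (P2 a ⊗ₜ[k] P3 a)) *
        (∑ i ∈ Finset.range (n h), ∑ j ∈ Finset.range (n (d1 h i)),
          d1 (d1 h i) j ⊗ₜ[k] (d2 (d1 h i) j ⊗ₜ[k] d2 h i)) *
        (∑ b ∈ Finset.range nq, Q1 b ⊗ₜ[k] (Q2 b ⊗ₜ[k] Q3 b))
  counit_left : ∀ h : H, ∑ i ∈ Finset.range (n h), counit (d1 h i) • d2 h i = h
  counit_right : ∀ h : H, ∑ i ∈ Finset.range (n h), counit (d2 h i) • d1 h i = h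
  pentagon :
    (∑ a ∈ Finset.range np, P1 a ⊗ₜ[k] (P2 a ⊗ₜ[k] comul (P3 a))) *
      (∑ a ∈ Finset.range np, ∑ i ∈ Finset.range (n (P1 a)),
        d1 (P1 a) i ⊗ₜ[k] (d2 (P1 a) i ⊗ₜ[k] (P2 a ⊗ₜ[k] P3 a))) =
    ((1 : H) ⊗ₜ[k] (∑ a ∈ Finset.range np, P1 a ⊗ₜ[k] (P2 a ⊗ₜ[k] P3 a))) *
      (∑ a ∈ Finset.range np, ∑ i ∈ Finset.range (n (P2 a)),
        P1 a ⊗ₜ[k] (d1 (P2 a) i ⊗ₜ[k] (d2 (P2 a) i ⊗ₜ[k] P3 a))) *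
      (∑ a ∈ Finset.range np, P1 a ⊗ₜ[k] (P2 a ⊗ₜ[k] (P3 a ⊗ₜ[k] (1 : H))))
  counit_mid_phi :
    ∑ a ∈ Finset.range np, counit (P2 a) • (P1 a ⊗ₜ[k] P3 a) = (1 : H) ⊗ₜ[k] (1 : H)
  antipode_alpha : ∀ h : H,
    ∑ i ∈ Finset.range (n h), S (d1 h i) * alpha * d2 h i = counit h • alpha
  antipode_beta : ∀ h : H,
    ∑ i ∈ Finset.range (n h), d1 h i * beta * S (d2 h i) = counit h • beta
  nondeg_1 : ∑ a ∈ Finset.range np, P1 a * beta * S (P2 a) * alpha * P3 a = 1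
  nondeg_2 : ∑ b ∈ Finset.range nq, S (Q1 b) * alpha * Q2 b * beta * S (Q3 b) = 1
  counit_alpha : counit alpha = 1
  counit_beta : counit beta = 1

namespace QuasiHopf

variable {k H : Type} [Field k] [Ring H] [Algebra k H] (q : QuasiHopf k H)

/-- The associator `φ` as an element of `H ⊗ H ⊗ H`. -/
def Phi : H ⊗[k] (H ⊗[k] H) :=
  ∑ a ∈ Finset.range q.np, q.P1 a ⊗ₜ[k] (q.P2 a ⊗ₜ[k] q.P3 a)

/-- `φ⁻¹` as an element of `H ⊗ H ⊗ H`. -/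
def PhiInv : H ⊗[k] (H ⊗[k] H) :=
  ∑ b ∈ Finset.range q.nq, q.Q1 b ⊗ₜ[k] (q.Q2 b ⊗ₜ[k] q.Q3 b)

/-- first components of `p^R = φ̄1 ⊗ φ̄2 β S(φ̄3)` -/
def pR1 (b : ℕ) : H := q.Q1 b

def pR2 (b : ℕ) : H := q.Q2 b * q.beta * q.S (q.Q3 b)

def pRE : H ⊗[k] H := ∑ b ∈ Finset.range q.nq, q.pR1 b ⊗ₜ[k] q.pR2 b

/-- components of `q^R = φ1 ⊗ S̄(α φ3) φ2` -/
def qR1 (a : ℕ) : H := q.P1 a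

def qR2 (a : ℕ) : H := q.Sinv (q.alpha * q.P3 a) * q.P2 a

def qRE : H ⊗[k] H := ∑ a ∈ Finset.range q.np, q.qR1 a ⊗ₜ[k] q.qR2 a

/-- components of `p^L = φ2 S̄(φ1 β) ⊗ φ3` -/
def pL1 (a : ℕ) : H := q.P2 a * q.Sinv (q.P1 a * q.beta)

def pL2 (a : ℕ) : H := q.P3 a

def pLE : H ⊗[k] H := ∑ a ∈ Finset.range q.np, q.pL1 a ⊗ₜ[k] q.pL2 a

/-- components of `q^L = S(φ̄1) α φ̄2 ⊗ φ̄3` -/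
def qL1 (b : ℕ) : H := q.S (q.Q1 b) * q.alpha * q.Q2 b

def qL2 (b : ℕ) : H := q.Q3 b

def qLE : H ⊗[k] H := ∑ b ∈ Finset.range q.nq, q.qL1 b ⊗ₜ[k] q.qL2 b

/-- `𝕒 = S(φ̄1 φ2) α φ̄2 φ3₍₁₎ ⊗ S(φ1) α φ̄3 φ3₍₂₎` -/
def aEl : H ⊗[k] H :=
  ∑ a ∈ Finset.range q.np, ∑ b ∈ Finset.range q.nq, ∑ m ∈ Finset.range (q.n (q.P3 a)),
    (q.S (q.Q1 b * q.P2 a) * q.alpha * q.Q2 b * q.d1 (q.P3 a) m) ⊗ₜ[k]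
      (q.S (q.P1 a) * q.alpha * q.Q3 b * q.d2 (q.P3 a) m)

/-- `𝕓 = φ1₍₁₎ φ̄1 β S(φ3) ⊗ φ1₍₂₎ φ̄2 β S(φ2 φ̄3)` -/
def bEl : H ⊗[k] H :=
  ∑ a ∈ Finset.range q.np, ∑ b ∈ Finset.range q.nq, ∑ m ∈ Finset.range (q.n (q.P1 a)),
    (q.d1 (q.P1 a) m * q.Q1 b * q.beta * q.S (q.P3 a)) ⊗ₜ[k]
      (q.d2 (q.P1 a) m * q.Q2 b * q.beta * q.S (q.P2 a * q.Q3 b))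

/-- `(S ⊗ S)(Δ^cop x) = S(x₍₂₎) ⊗ S(x₍₁₎)` -/
def scop (x : H) : H ⊗[k] H :=
  ∑ m ∈ Finset.range (q.n x), q.S (q.d2 x m) ⊗ₜ[k] q.S (q.d1 x m)

/-- The Drinfeld twist `f = (S⊗S)(Δ^cop(p^R_1)) · 𝕒 · Δ(p^R_2)`. -/
def twist : H ⊗[k] H :=
  ∑ b ∈ Finset.range q.nq, q.scop (q.pR1 b) * q.aEl * q.comul (q.pR2 b)

/-- `f⁻¹ = Δ(q^L_1) · 𝕓 · (S⊗S)(Δ^cop(q^L_2))`. -/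
def twistInv : H ⊗[k] H :=
  ∑ b ∈ Finset.range q.nq, q.comul (q.qL1 b) * q.bEl * q.scop (q.qL2 b)

/-- `x ⊗ y ↦ S y ⊗ S x` -/
def sswap : H ⊗[k] H →ₗ[k] H ⊗[k] H :=
  (TensorProduct.map q.S q.S).comp (TensorProduct.comm k H H).toLinearMap

/-- `x ⊗ y ↦ S̄ y ⊗ S̄ x` -/
def sswapInv : H ⊗[k] H →ₗ[k] H ⊗[k] H :=
  (TensorProduct.map q.Sinv q.Sinv).comp (TensorProduct.comm k H H).toLinearMap

/-- `U^L = f̄1 S(q^R_2) ⊗ f̄2 S(q^R_1)` -/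
def UL : H ⊗[k] H := q.twistInv * q.sswap q.qRE

/-- `V^L = S̄(f2 p^R_2) ⊗ S̄(f1 p^R_1)` -/
def VL : H ⊗[k] H := q.sswapInv (q.twist * q.pRE)

/-- `U^R = S̄(q^L_2 f̄2) ⊗ S̄(q^L_1 f̄1)` -/
def UR : H ⊗[k] H := q.sswapInv (q.qLE * q.twistInv)

/-- `V^R = S(p^L_2) f1 ⊗ S(p^L_1) f2` -/
def VR : H ⊗[k] H := q.sswap q.pLE * q.twist

/-- `h ↦ h ↼ μ = μ(h₍₁₎) h₍₂₎` -/
def lhook (mu : H →ₐ[k] k) : H →ₗ[k] H :=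
  (TensorProduct.lid k H).toLinearMap.comp
    ((TensorProduct.map mu.toLinearMap LinearMap.id).comp q.comul.toLinearMap)

/-- `h ↦ μ ⇀ h = μ(h₍₂₎) h₍₁₎` -/
def rhook (mu : H →ₐ[k] k) : H →ₗ[k] H :=
  (TensorProduct.rid k H).toLinearMap.comp
    ((TensorProduct.map LinearMap.id mu.toLinearMap).comp q.comul.toLinearMap)

/-- `W^L = μ(φ̄1) f̄1 S(q^R_2 φ̄3) ⊗ f̄2 S((q^R_1 ↼ μ) φ̄2)` -/
def WL (mu : H →ₐ[k] k) : H ⊗[k] H :=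
  q.twistInv * q.sswap ((TensorProduct.map (q.lhook mu) LinearMap.id q.qRE) *
    (∑ b ∈ Finset.range q.nq, mu (q.Q1 b) • (q.Q2 b ⊗ₜ[k] q.Q3 b)))

/-- `W^R = μ(φ3) S̄((μ ⇀ q^L_2) φ2 f̄2) ⊗ S̄(q^L_1 φ1 f̄1)` -/
def WR (mu : H →ₐ[k] k) : H ⊗[k] H :=
  q.sswapInv ((TensorProduct.map LinearMap.id (q.rhook mu) q.qLE) *
    (∑ a ∈ Finset.range q.np, mu (q.P3 a) • (q.P1 a ⊗ₜ[k] q.P2 a)) * q.twistInv)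

section Modules

variable {V W X : Type} [AddCommGroup V] [Module k V] [AddCommGroup W] [Module k W]
  [AddCommGroup X] [Module k X]

/-- The tensor-product action `h · (v ⊗ w) = h₍₁₎ v ⊗ h₍₂₎ w`. -/
def tensAct (ρV : H → Module.End k V) (ρW : H → Module.End k W) (h : H) :
    Module.End k (V ⊗[k] W) :=
  ∑ i ∈ Finset.range (q.n h), TensorProduct.map (ρV (q.d1 h i)) (ρW (q.d2 h i))

/-- The action on the left dual: `(h · ξ)(x) = ξ(S(h) x)`. -/
def dualAct (ρX : H → Module.End k X) (h : H) : Module.End k (Module.Dual k X) :=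
  LinearMap.dualMap (ρX (q.S h))

end Modules

end QuasiHopf

/-- `f` intertwines the two given `H`-actions. -/
def IsHLin {k H V W : Type} [Field k] [Ring H] [Algebra k H]
    [AddCommGroup V] [Module k V] [AddCommGroup W] [Module k W]
    (ρV : H → Module.End k V) (ρW : H → Module.End k W) (f : V →ₗ[k] W) : Prop :=
  ∀ (h : H) (v : V), f (ρV h v) = ρW h (f v)

/-- `x ⊗ y ↦ λ(y) • x` -/
def hitR {k H : Type} [Field k] [Ring H] [Algebra k H] (lam : H →ₗ[k] k) :
    H ⊗[k] H →ₗ[k] H :=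
  (TensorProduct.rid k H).toLinearMap.comp (TensorProduct.map LinearMap.id lam)

/-- `x ⊗ y ↦ λ(x) • y` -/
def hitL {k H : Type} [Field k] [Ring H] [Algebra k H] (lam : H →ₗ[k] k) :
    H ⊗[k] H →ₗ[k] H :=
  (TensorProduct.lid k H).toLinearMap.comp (TensorProduct.map lam LinearMap.id)

namespace QuasiHopf

variable {k H : Type} [Field k] [Ring H] [Algebra k H] (q : QuasiHopf k H)
variable {V : Type} [AddCommGroup V] [Module k V]

/-- The action `h · (a ⊗ v) = h₍₁,₁₎ a S(h₍₂₎) ⊗ h₍₁,₂₎ v` on `H ⊗ V`. -/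
def actOn (ρ : H → Module.End k V) (h : H) : Module.End k (H ⊗[k] V) :=
  ∑ i ∈ Finset.range (q.n h), ∑ j ∈ Finset.range (q.n (q.d1 h i)),
    TensorProduct.map
      ((LinearMap.mulLeft k (q.d1 (q.d1 h i) j)).comp
        (LinearMap.mulRight k (q.S (q.d2 h i))))
      (ρ (q.d2 (q.d1 h i) j))

/-- The (second-kind) coaction
`δ(a ⊗ v) = ω1 a₍₁₎ ω5 ⊗ (ω2 a₍₂₎ ω4 ⊗ ω3 v)` on `H ⊗ V`, where
`ω = (1⊗1⊗1⊗f̄2⊗f̄1) · (id⊗Δ⊗S⊗S)(χ) · (φ⊗1⊗1)` and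
`χ = (φ⊗1) · (Δ⊗id⊗id)(φ⁻¹)`.  Written out with
`χ = φ1 φ̄1₍₁₎ ⊗ φ2 φ̄1₍₂₎ ⊗ φ3 φ̄2 ⊗ φ̄3`, the five components of `ω` are
`ω1 = χ1 φ'1`, `ω2 = (χ2)₍₁₎ φ'2`, `ω3 = (χ2)₍₂₎ φ'3`, `ω4 = f̄2 S(χ3)`,
`ω5 = f̄1 S(χ4)`. -/
def coactOn (ρ : H → Module.End k V) : H ⊗[k] V →ₗ[k] H ⊗[k] (H ⊗[k] V) :=
  ∑ a ∈ Finset.range q.np, ∑ b ∈ Finset.range q.nq,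
    ∑ m ∈ Finset.range (q.n (q.Q1 b)), ∑ c ∈ Finset.range q.np,
      ∑ e ∈ Finset.range (q.n (q.P2 a * q.d2 (q.Q1 b) m)),
        (TensorProduct.assoc k H H V).toLinearMap ∘ₗ
          TensorProduct.map
            ((LinearMap.mulLeft k
                ((q.P1 a * q.d1 (q.Q1 b) m * q.P1 c) ⊗ₜ[k]
                  (q.d1 (q.P2 a * q.d2 (q.Q1 b) m) e * q.P2 c))).comp
              ((LinearMap.mulRight k
                  (q.twistInv * (q.S (q.Q3 b) ⊗ₜ[k] q.S (q.P3 a * q.Q2 b)))).comp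
                q.comul.toLinearMap))
            (ρ (q.d2 (q.P2 a * q.d2 (q.Q1 b) m) e * q.P3 c))

end QuasiHopf

namespace QuasiHopf

/-- The algebra `H ⊗ Y`, sealed so that iterated tensor powers stay tractable. -/
def Ten (k H Y : Type) [Field k] [Ring H] [Algebra k H] [Ring Y] [Algebra k Y] : Type :=
  H ⊗[k] Y

namespace Ten

variable {k H : Type} [Field k] [Ring H] [Algebra k H]
variable {Y Y' Y'' : Type} [Ring Y] [Algebra k Y] [Ring Y'] [Algebra k Y']
  [Ring Y''] [Algebra k Y'']

instance : Ring (Ten k H Y) := inferInstanceAs (Ring (H ⊗[k] Y))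

instance : Algebra k (Ten k H Y) := inferInstanceAs (Algebra k (H ⊗[k] Y))

/-- The identification of `H ⊗ Y` with its sealed copy. -/
def of : H ⊗[k] Y ≃ₐ[k] Ten k H Y := AlgEquiv.refl

/-- The pure tensor `x ⊗ y`. -/
def pt (x : H) (y : Y) : Ten k H Y := of (x ⊗ₜ[k] y)

@[elab_as_elim] lemma ind {p : Ten k H Y → Prop} (z : Ten k H Y) (zero : p 0)
    (pt : ∀ x y, p (pt x y)) (add : ∀ x y, p x → p y → p (x + y)) : p z :=
  TensorProduct.induction_on (motive := p) z zero pt add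

lemma pt_mul (x x' : H) (y y' : Y) : (pt x y * pt x' y' : Ten k H Y) = pt (x * x') (y * y') :=
  Algebra.TensorProduct.tmul_mul_tmul x x' y y'

lemma pt_one : (pt 1 1 : Ten k H Y) = 1 := rfl

lemma sum_pt {ι : Type} (s : Finset ι) (f : ι → H) (y : Y) :
    (pt (∑ i ∈ s, f i) y : Ten k H Y) = ∑ i ∈ s, pt (f i) y :=
  TensorProduct.sum_tmul s f y

lemma pt_sum {ι : Type} (s : Finset ι) (x : H) (f : ι → Y) :
    (pt x (∑ i ∈ s, f i) : Ten k H Y) = ∑ i ∈ s, pt x (f i) :=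
  TensorProduct.tmul_sum x s f

lemma smul_pt (c : k) (x : H) (y : Y) : (pt (c • x) y : Ten k H Y) = c • pt x y := rfl

lemma pt_smul (c : k) (x : H) (y : Y) : (pt x (c • y) : Ten k H Y) = c • pt x y :=
  TensorProduct.tmul_smul c x y

lemma pt_add (x : H) (y y' : Y) : (pt x (y + y') : Ten k H Y) = pt x y + pt x y' :=
  TensorProduct.tmul_add x y y'

/-- The linear map induced by a bilinear map. -/
def linLift {M : Type} [AddCommGroup M] [Module k M] (f : H →ₗ[k] Y →ₗ[k] M) :
    Ten k H Y →ₗ[k] M :=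
  (TensorProduct.lift f).comp of.symm.toLinearMap

@[simp] lemma linLift_pt {M : Type} [AddCommGroup M] [Module k M] (f : H →ₗ[k] Y →ₗ[k] M)
    (x : H) (y : Y) : linLift f (pt x y) = f x y := rfl

/-- The algebra map induced by two commuting algebra maps. -/
def algLift {E : Type} [Semiring E] [Algebra k E] (f : H →ₐ[k] E) (g : Y →ₐ[k] E)
    (h : ∀ x y, Commute (f x) (g y)) : Ten k H Y →ₐ[k] E :=
  (Algebra.TensorProduct.lift f g h).comp of.symm.toAlgHom

@[simp] lemma algLift_pt {E : Type} [Semiring E] [Algebra k E] (f : H →ₐ[k] E) (g : Y →ₐ[k] E)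
    (h : ∀ x y, Commute (f x) (g y)) (x : H) (y : Y) :
    algLift f g h (pt x y) = f x * g y := rfl

lemma hom_ext {f g : Ten k H Y →ₐ[k] Y'} (h : ∀ x y, f (pt x y) = g (pt x y)) : f = g := by
  ext z
  induction z using ind with
  | zero => simp
  | pt x y => exact h x y
  | add x y hx hy => simp [hx, hy]

/-- `id ⊗ g` -/
def sh (g : Y →ₐ[k] Y') : Ten k H Y →ₐ[k] Ten k H Y' :=
  of.toAlgHom.comp ((Algebra.TensorProduct.map (AlgHom.id k H) g).comp of.symm.toAlgHom)

/-- `y ↦ 1 ⊗ y` -/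
def un : Y →ₐ[k] Ten k H Y := of.toAlgHom.comp Algebra.TensorProduct.includeRight

@[simp] lemma sh_pt (g : Y →ₐ[k] Y') (x : H) (y : Y) :
    sh g (pt x y : Ten k H Y) = pt x (g y) := rfl

lemma un_apply (y : Y) : (un y : Ten k H Y) = pt 1 y := rfl

lemma sh_sh (f : Y' →ₐ[k] Y'') (g : Y →ₐ[k] Y') (z : Ten k H Y) :
    sh f (sh g z) = sh (f.comp g) z := by
  have : (sh f).comp (sh g) = (sh (f.comp g) : Ten k H Y →ₐ[k] _) := hom_ext fun x y => rfl
  exact DFunLike.congr_fun this z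

lemma sh_un (g : Y →ₐ[k] Y') (y : Y) : sh g (un y : Ten k H Y) = un (g y) := rfl

end Ten

open Ten

section Tower

variable {k H : Type} [Field k] [Ring H] [Algebra k H] (q : QuasiHopf k H)
variable {Y Y' Y'' : Type} [Ring Y] [Algebra k Y] [Ring Y'] [Algebra k Y']
  [Ring Y''] [Algebra k Y'']

/-- `Δ ⊗ id` -/
def cm : Ten k H Y →ₐ[k] Ten k H (Ten k H Y) :=
  ((of.toAlgHom.comp (Algebra.TensorProduct.map (AlgHom.id k H) of.toAlgHom)).comp
    ((Algebra.TensorProduct.assoc k k k H H Y).toAlgHom.comp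
      (Algebra.TensorProduct.map q.comul (AlgHom.id k Y)))).comp of.symm.toAlgHom

/-- `ε ⊗ id` -/
def cu : Ten k H Y →ₐ[k] Y :=
  ((Algebra.TensorProduct.lid k Y).toAlgHom.comp
    (Algebra.TensorProduct.map q.counit (AlgHom.id k Y))).comp of.symm.toAlgHom

@[simp] lemma cu_pt (x : H) (y : Y) : q.cu (pt x y) = q.counit x • y := by
  change (Algebra.TensorProduct.lid k Y)
    (Algebra.TensorProduct.map q.counit (AlgHom.id k Y) (x ⊗ₜ y)) = _
  simp

lemma cm_pt (x : H) (y : Y) : q.cm (pt x y) =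
    ∑ i ∈ Finset.range (q.n x), pt (q.d1 x i) (pt (q.d2 x i) y) := by
  change (of.toAlgHom.comp (Algebra.TensorProduct.map (AlgHom.id k H) of.toAlgHom))
    ((Algebra.TensorProduct.assoc k k k H H Y) (q.comul x ⊗ₜ[k] y)) = _
  rw [comul_eq, TensorProduct.sum_tmul, map_sum, map_sum]; rfl

lemma cm_un (y : Y) : q.cm (un y) = un (un y) := by
  change (of.toAlgHom.comp (Algebra.TensorProduct.map (AlgHom.id k H) of.toAlgHom))
    ((Algebra.TensorProduct.assoc k k k H H Y) (q.comul 1 ⊗ₜ[k] y)) = _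
  rw [map_one]; rfl

lemma cu_un (y : Y) : q.cu (un y) = y := by simp [un_apply]

lemma cm_sh (g : Y →ₐ[k] Y') (z : Ten k H Y) : q.cm (sh g z) = sh (sh g) (q.cm z) := by
  have : q.cm.comp (sh g) = (sh (sh g)).comp q.cm := hom_ext fun x y => by
    simp [cm_pt]
  exact DFunLike.congr_fun this z

lemma cu_sh (g : Y →ₐ[k] Y') (z : Ten k H Y) : q.cu (sh g z) = g (q.cu z) := by
  have : q.cu.comp (sh g) = g.comp q.cu := hom_ext fun x y => by
    simp
  exact DFunLike.congr_fun this z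

lemma cu_cm (z : Ten k H Y) : q.cu (q.cm z) = z := by
  have : q.cu.comp q.cm = AlgHom.id k (Ten k H Y) := hom_ext fun x y => by
    conv_rhs => rw [← q.counit_left x]
    simp [cm_pt, sum_pt, smul_pt]
  exact DFunLike.congr_fun this z

lemma sh_cu_cm (z : Ten k H Y) : sh q.cu (q.cm z) = z := by
  have : (sh q.cu).comp q.cm = AlgHom.id k (Ten k H Y) := hom_ext fun x y => by
    conv_rhs => rw [← q.counit_right x]
    simp [cm_pt, sum_pt, smul_pt, pt_smul]
  exact DFunLike.congr_fun this z

/-- `x ⊗ y ⊗ z ↦ x ⊗ y ⊗ z ⊗ 1` -/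
def tl : H ⊗[k] (H ⊗[k] H) →ₐ[k] Ten k H (Ten k H (Ten k H Y)) :=
  of.toAlgHom.comp (Algebra.TensorProduct.map (AlgHom.id k H)
    (of.toAlgHom.comp (Algebra.TensorProduct.map (AlgHom.id k H)
      (of.toAlgHom.comp Algebra.TensorProduct.includeLeft))))

@[simp] lemma tl_tmul (x y z : H) : (tl (x ⊗ₜ[k] (y ⊗ₜ[k] z)) : Ten k H (Ten k H (Ten k H Y))) =
    pt x (pt y (pt z 1)) := rfl

/-- The associator, followed by the unit of `Y`. -/
def ph (Y : Type) [Ring Y] [Algebra k Y] : (Ten k H (Ten k H (Ten k H Y)))ˣ where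
  val := tl q.Phi
  inv := tl q.PhiInv
  val_inv := by rw [← map_mul, Phi, PhiInv, q.phi_phiInv, map_one]
  inv_val := by rw [← map_mul, Phi, PhiInv, q.phiInv_phi, map_one]

lemma ph_val : (q.ph Y).val =
    ∑ a ∈ Finset.range q.np, pt (q.P1 a) (pt (q.P2 a) (pt (q.P3 a) 1)) := by
  simp [ph, Phi]

lemma ph_inv_val : (q.ph Y)⁻¹.val =
    ∑ a ∈ Finset.range q.nq, pt (q.Q1 a) (pt (q.Q2 a) (pt (q.Q3 a) 1)) := by
  change tl q.PhiInv = _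
  simp [PhiInv]

lemma sh_ph (g : Y →ₐ[k] Y') : sh (sh (sh g)) (q.ph Y).val = (q.ph Y').val := by
  simp [ph_val]

lemma ph_comm (y : Y) : (q.ph Y).val * un (un (un y)) = un (un (un y)) * (q.ph Y).val := by
  simp [ph_val, Finset.sum_mul, Finset.mul_sum, un_apply, pt_mul]

lemma cm_coassoc (z : Ten k H Y) :
    sh q.cm (q.cm z) * (q.ph Y).val = (q.ph Y).val * q.cm (q.cm z) := by
  suffices h : sh q.cm (q.cm z) = (q.ph Y).val * q.cm (q.cm z) * (q.ph Y)⁻¹.val by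
    rw [h, Units.inv_mul_cancel_right]
  induction z using ind with
  | zero => simp
  | add x y hx hy => simp [hx, hy, mul_add, add_mul]
  | pt h y =>
    have h2 := congr_arg (fun t => (tl t : Ten k H (Ten k H (Ten k H Y))) * un (un (un y)))
      (q.qcoassoc h)
    simp only [map_mul] at h2
    change _ = ((q.ph Y).val * _ * (q.ph Y)⁻¹.val) * _ at h2
    have h3 : (q.ph Y)⁻¹.val * un (un (un y)) = un (un (un y)) * (q.ph Y)⁻¹.val := by
      simp [ph_inv_val, Finset.sum_mul, Finset.mul_sum, un_apply, pt_mul]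
    rw [mul_assoc _ _ (un (un (un y))), h3, ← mul_assoc, mul_assoc (q.ph Y).val] at h2
    convert h2 using 1
    · simp [cm_pt, comul_eq, Finset.sum_mul, TensorProduct.tmul_sum, un_apply, pt_mul, pt_sum]
    · congr 2
      simp [cm_pt, Finset.sum_mul, un_apply, pt_mul]

/-- `x ⊗ y ⊗ z ⊗ w ↦ x ⊗ y ⊗ z ⊗ w ⊗ 1` -/
def tll : H ⊗[k] (H ⊗[k] (H ⊗[k] H)) →ₐ[k] Ten k H (Ten k H (Ten k H (Ten k H Y))) :=
  of.toAlgHom.comp (Algebra.TensorProduct.map (AlgHom.id k H) tl)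

@[simp] lemma tll_tmul (x y z w : H) :
    (tll (x ⊗ₜ[k] (y ⊗ₜ[k] (z ⊗ₜ[k] w))) : Ten k H (Ten k H (Ten k H (Ten k H Y)))) =
    pt x (pt y (pt z (pt w 1))) := rfl

lemma ph_pentagon : sh (sh q.cm) (q.ph Y).val * q.cm (q.ph Y).val =
    un (q.ph Y).val * sh q.cm (q.ph Y).val * (q.ph (Ten k H Y)).val := by
  have h := congr_arg (tll (k := k) (H := H) (Y := Y)) q.pentagon
  simp only [map_mul] at h
  convert h using 2
  · simp [ph_val, cm_pt, comul_eq, TensorProduct.tmul_sum, pt_sum]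
  · simp [ph_val, cm_pt]
  · simp [ph_val, cm_pt, TensorProduct.tmul_sum, pt_sum, un_apply]
  · simp [ph_val, ← pt_one]

lemma sh_cu_ph : sh q.cu (q.ph Y).val = 1 := by
  have h := congr_arg (of.toAlgHom.comp (Algebra.TensorProduct.map (AlgHom.id k H)
    (of.toAlgHom.comp Algebra.TensorProduct.includeLeft)) :
    H ⊗[k] H →ₐ[k] Ten k H (Ten k H Y)) q.counit_mid_phi
  convert h using 1
  · simp only [ph_val, map_sum, sh_pt, cu_pt, map_smul, pt_smul]
    rfl
  · exact (map_one _).symm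

end Tower

section Units

variable {k X Y Z : Type} [Field k] [Ring X] [Algebra k X] [Ring Y] [Algebra k Y]
  [Ring Z] [Algebra k Z]

/-- The map induced on units by an algebra map. -/
def um (g : X →ₐ[k] Y) : Xˣ →* Yˣ := Units.map (g : X →* Y)

lemma um_val (g : X →ₐ[k] Y) (u : Xˣ) : (um g u).val = g u.val := rfl

end Units

section Coherence

variable {k H : Type} [Field k] [Ring H] [Algebra k H] (q : QuasiHopf k H)
variable {Y Y' Y'' : Type} [Ring Y] [Algebra k Y] [Ring Y'] [Algebra k Y']
  [Ring Y''] [Algebra k Y'']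

lemma sh_sh_congr {f : Y' →ₐ[k] Y} {g : Y'' →ₐ[k] Y'} {X : Type} [Ring X] [Algebra k X]
    {f' : X →ₐ[k] Y} {g' : Y'' →ₐ[k] X} (h : ∀ y, f (g y) = f' (g' y)) (z : Ten k H Y'') :
    sh f (sh g z) = sh f' (sh g' z) := by
  rw [sh_sh, sh_sh, show f.comp g = f'.comp g' from AlgHom.ext h]

lemma sh_sh_comp (f : Y' →ₐ[k] Y) (g : Y'' →ₐ[k] Y')
    (z : Ten k H (Ten k H Y'')) : sh (sh (f.comp g)) z = sh (sh f) (sh (sh g) z) := by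
  rw [sh_sh, show (sh f).comp (sh g) = sh (f.comp g) from AlgHom.ext fun z => sh_sh f g z]

lemma sh_sh_id {f : Y' →ₐ[k] Y} {g : Y →ₐ[k] Y'} (h : ∀ y, f (g y) = y) (z : Ten k H Y) :
    sh f (sh g z) = z := by
  rw [sh_sh, show f.comp g = AlgHom.id k Y from AlgHom.ext h]
  exact DFunLike.congr_fun (hom_ext fun _ _ => rfl : sh (AlgHom.id k Y) = AlgHom.id k _) z

lemma cu_ph : q.cu (q.ph Y).val = 1 := by
  have h := congr_arg (sh q.cu) (q.ph_pentagon (Y := Y))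
  rw [map_mul, map_mul, map_mul, sh_cu_cm, sh_un, sh_sh_id q.cu_cm, sh_cu_ph,
    sh_sh_congr (f' := q.cm) (g' := q.cu) (fun y => q.cu_sh q.cm y), sh_cu_ph, map_one,
    one_mul, mul_one] at h
  have h2 := congr_arg (fun t => q.cu (t * (q.ph Y)⁻¹.val)) h
  simp only [Units.mul_inv_cancel_right, Units.mul_inv, map_one, cu_un] at h2
  exact h2.symm

lemma sh_sh_cu_ph : sh (sh q.cu) (q.ph Y).val = 1 := by
  have h := congr_arg (sh (sh q.cu)) (q.ph_pentagon (Y := Y))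
  rw [map_mul, map_mul, map_mul, ← cm_sh, sh_cu_ph, map_one, mul_one, sh_un, sh_cu_ph, map_one,
    one_mul, sh_sh_id (sh_sh_id q.cu_cm), sh_sh_id q.sh_cu_cm] at h
  have h2 : sh (sh q.cu) (q.ph (Ten k H Y)).val = 1 := by
    have := congr_arg (fun t => (q.ph Y)⁻¹.val * t) h
    simp only [Units.inv_mul_cancel_left, Units.inv_mul] at this
    exact this.symm
  rw [← q.sh_ph (q.cu (Y := Y)), sh_sh_congr (f' := sh q.cu) (g' := sh q.cu), h2, map_one]
  exact sh_sh_congr fun y => q.cu_sh q.cu y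

end Coherence

section Words
lemma word_quasi_coassoc {G : Type} [Group G]
    {a1 a2 a3 a4 a5 a6 a7 a8 b1 b2 b3 b4 b5 b6 c4 c5 d e f g1 g2 g3 h : G}
    (n1 : c4 * a3 = a3 * a4) (n2 : c5 * a3 = a3 * a5) (p1 : d * b6 = a3 * a6 * a7)
    (k1 : b6 * a8 = a8 * b6) (k2 : d * a8 = a8 * d) (p2 : b3 * b4 = a1 * e * d)
    (n3 : f * d = d * b5) (n4 : b2 * a1 = a1 * g2) (n5 : b1 * a1 = a1 * g1)
    (n6 : g2 * e = e * g3) (p3 : c4 * h = a2 * g1 * e) (p4 : f * g3 = a8 * c5 * h) :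
    (a1 * a2⁻¹ * a3) * (a4 * a5⁻¹ * a6) * (a7 * a8⁻¹) =
      (b1 * b2⁻¹ * b3) * (b4 * b5⁻¹ * b6) := by
  obtain rfl : a4 = a3⁻¹ * c4 * a3 := by rw [mul_assoc, n1]; group
  obtain rfl : a5 = a3⁻¹ * c5 * a3 := by rw [mul_assoc, n2]; group
  obtain rfl : a7 = a6⁻¹ * a3⁻¹ * d * b6 := by rw [mul_assoc _ d, p1]; group
  obtain rfl : b4 = b3⁻¹ * a1 * e * d := by rw [mul_assoc, mul_assoc, ← mul_assoc a1, ← p2]; group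
  obtain rfl : b5 = d⁻¹ * f * d := by rw [mul_assoc, n3]; group
  obtain rfl : b1 = a1 * g1 * a1⁻¹ := by rw [← n5]; group
  obtain rfl : b2 = a1 * g2 * a1⁻¹ := by rw [← n4]; group
  obtain rfl : g3 = e⁻¹ * g2 * e := by rw [mul_assoc, n6]; group
  obtain rfl : c4 = a2 * g1 * e * h⁻¹ := by rw [← p3]; group
  obtain rfl : f = a8 * c5 * h * (e⁻¹ * g2 * e)⁻¹ := by rw [← p4]; group
  have k1' : b6 * a8⁻¹ = a8⁻¹ * b6 := (Commute.inv_right (show Commute b6 a8 from k1)).eq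
  have k2' : d * a8⁻¹ = a8⁻¹ * d := (Commute.inv_right (show Commute d a8 from k2)).eq
  have k3 : d * b6 * a8⁻¹ = a8⁻¹ * d * b6 := by rw [mul_assoc, k1', ← mul_assoc, k2']
  calc _ = a1 * g1 * e * h⁻¹ * c5⁻¹ * (d * b6 * a8⁻¹) := by group
    _ = _ := by rw [k3]; group

lemma word_twist {G : Type} [Group G] {p s A A' B C D K L M M' R U V W X Y : G}
    (k1 : p * s = s * p) (n1 : A * p = p * A') (p1 : K * L = s * A' * M)
    (n2 : U * R = R * L) (n3 : M' * p = p * M) (p2 : B * M' = C * X * Y)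
    (n4 : W * D = D * X) (p3 : V * R = D * Y * p) :
    (p⁻¹ * s) * ((A * B⁻¹) * (C * D⁻¹)) = (K * R⁻¹) * (U * V⁻¹ * W⁻¹) := by
  obtain rfl : A = p * A' * p⁻¹ := by rw [← n1]; group
  obtain rfl : U = R * L * R⁻¹ := by rw [← n2]; group
  obtain rfl : M' = p * M * p⁻¹ := by rw [← n3]; group
  obtain rfl : W = D * X * D⁻¹ := by rw [← n4]; group
  obtain rfl : V = D * Y * p * R⁻¹ := by rw [← p3]; group
  obtain rfl : C = B * (p * M * p⁻¹) * Y⁻¹ * X⁻¹ := by rw [p2]; group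
  obtain rfl : K = s * A' * M * L⁻¹ := by rw [← p1]; group
  have : p⁻¹ * s = s * p⁻¹ := (Commute.inv_left (show Commute p s from k1)).eq
  rw [this]; group
end Words

section UnitCoherence

variable {k H : Type} [Field k] [Ring H] [Algebra k H] (q : QuasiHopf k H)
variable {Y Y' Y'' : Type} [Ring Y] [Algebra k Y] [Ring Y'] [Algebra k Y']
  [Ring Y''] [Algebra k Y'']

/-- `Δ` in the first leg, on units. -/
def uc : (Ten k H Y)ˣ →* (Ten k H (Ten k H Y))ˣ := um q.cm

/-- `Δ` in the second leg, on units. -/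
def uc1 : (Ten k H (Ten k H Y))ˣ →* (Ten k H (Ten k H (Ten k H Y)))ˣ := um (sh q.cm)

/-- `Δ` in the third leg, on units. -/
def uc2 : (Ten k H (Ten k H (Ten k H Y)))ˣ →* (Ten k H (Ten k H (Ten k H (Ten k H Y))))ˣ :=
  um (sh (sh q.cm))

/-- `y ↦ 1 ⊗ y`, on units. -/
def uu (k H : Type) [Field k] [Ring H] [Algebra k H] {Y : Type} [Ring Y] [Algebra k Y] :
    Yˣ →* (Ten k H Y)ˣ := um un

lemma uc2_uu (z : (Ten k H (Ten k H Y))ˣ) : q.uc2 (uu k H z) = uu k H (q.uc1 z) := rfl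

lemma uc1_uu (z : (Ten k H Y)ˣ) : q.uc1 (uu k H z) = uu k H (q.uc z) := rfl

lemma uc_uu (z : Yˣ) : q.uc (uu k H z) = uu k H (uu k H z) := Units.ext (q.cm_un z.val)

lemma uc_uc1 (z : (Ten k H (Ten k H Y))ˣ) : q.uc (q.uc1 z) = q.uc2 (q.uc z) :=
  Units.ext (q.cm_sh _ z.val)

lemma um_ph (g : Y →ₐ[k] Y') : um (sh (sh (sh g))) (q.ph Y) = q.ph Y' := Units.ext (q.sh_ph g)

lemma um_uc (g : Y →ₐ[k] Y') (z : (Ten k H Y)ˣ) :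
    um (sh (sh g)) (q.uc z) = q.uc (um (sh g) z) :=
  Units.ext (q.cm_sh g z.val).symm

lemma um_uc1 (g : Y →ₐ[k] Y') (z : (Ten k H (Ten k H Y))ˣ) :
    um (sh (sh (sh g))) (q.uc1 z) = q.uc1 (um (sh (sh g)) z) :=
  Units.ext (sh_sh_congr (fun y => (q.cm_sh g y).symm) z.val)

lemma uc_nat (z : (Ten k H Y)ˣ) :
    q.uc1 (q.uc z) * q.ph Y = q.ph Y * q.uc (q.uc z) :=
  Units.ext (q.cm_coassoc z.val)

lemma sh_mul_un {f g : Y →ₐ[k] Y'} {p : Y'} (h : ∀ y, f y * p = p * g y) (z : Ten k H Y) :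
    sh f z * un p = un p * sh g z := by
  induction z using ind with
  | zero => simp
  | pt x y => simp [un_apply, pt_mul, h]
  | add x y hx hy => simp [hx, hy, mul_add, add_mul]

lemma uc1_nat (z : (Ten k H (Ten k H Y))ˣ) :
    q.uc2 (q.uc1 z) * uu k H (q.ph Y) = uu k H (q.ph Y) * q.uc1 (q.uc1 z) := by
  refine Units.ext ?_
  change sh (sh q.cm) (sh q.cm z.val) * un (q.ph Y).val =
    un (q.ph Y).val * sh q.cm (sh q.cm z.val)
  rw [sh_sh, sh_sh]
  exact sh_mul_un q.cm_coassoc z.val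

lemma uc_pentagon : q.uc2 (q.ph Y) * q.uc (q.ph Y) =
    uu k H (q.ph Y) * q.uc1 (q.ph Y) * q.ph (Ten k H Y) :=
  Units.ext q.ph_pentagon

lemma ph_uu_comm (y : Yˣ) : q.ph Y * uu k H (uu k H (uu k H y)) = uu k H (uu k H (uu k H y)) * q.ph Y :=
  Units.ext (q.ph_comm y.val)

/-- The part `(id ⊗ Δ ⊗ id ⊗ id)((φ ⊗ 1)(Δ ⊗ id ⊗ id)(φ⁻¹)) (φ ⊗ 1 ⊗ 1)` of `ω` that does not
involve the twist, before applying the antipode. -/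
def om (Y : Type) [Ring Y] [Algebra k Y] :
    (Ten k H (Ten k H (Ten k H (Ten k H (Ten k H Y)))))ˣ :=
  q.uc1 (q.ph (Ten k H Y)) * (q.uc1 (q.uc (q.ph Y)))⁻¹ * q.ph (Ten k H (Ten k H Y))

/-- The rebracketing `(1 (2 3)) 4 → (1 2) (3 4)`. -/
def ww (Y : Type) [Ring Y] [Algebra k Y] : (Ten k H (Ten k H (Ten k H (Ten k H Y))))ˣ :=
  q.uc (q.ph Y) * (q.ph (Ten k H Y))⁻¹

lemma om_coassoc :
    uu k H (q.om (Ten k H Y)) *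
      um (sh q.cm) (um (sh (sh (sh q.cm))) (q.om Y)) *
      (q.ph (Ten k H (Ten k H (Ten k H (Ten k H Y)))) *
        (uu k H (uu k H (uu k H (uu k H (q.ph Y)))))⁻¹) =
    um (sh (sh q.cm)) (um (sh (sh q.cm)) (q.om Y)) *
      um q.cm (um (sh (sh (sh (sh q.cm)))) (q.om Y)) := by
  have w := word_quasi_coassoc (q.uc1_nat (q.uc2 (q.ph (Ten k H Y))))
    (q.uc1_nat (q.uc (q.uc1 (q.ph Y))))
    (q.uc_pentagon (Y := Ten k H (Ten k H (Ten k H Y))))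
    (a8 := uu k H (uu k H (uu k H (uu k H (q.ph Y)))))
    (a1 := uu k H (q.uc1 (q.ph (Ten k H (Ten k H Y)))))
    (a2 := uu k H (q.uc1 (q.uc (q.ph (Ten k H Y)))))
    (b1 := q.uc2 (q.uc2 (q.uc1 (q.ph (Ten k H Y)))))
    (b2 := q.uc2 (q.uc2 (q.uc1 (q.uc (q.ph Y)))))
    (b3 := q.uc2 (q.uc2 (q.ph (Ten k H (Ten k H Y)))))
    (b4 := q.uc2 (q.uc (q.ph (Ten k H (Ten k H Y)))))
    (b5 := q.uc2 (q.uc (q.uc (q.uc2 (q.ph Y)))))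
    (e := q.uc2 (q.uc1 (q.ph (Ten k H (Ten k H Y)))))
    (f := q.uc2 (q.uc1 (q.uc (q.uc2 (q.ph Y)))))
    (g1 := q.uc2 (q.uc1 (q.uc1 (q.ph (Ten k H Y)))))
    (g2 := q.uc2 (q.uc1 (q.uc1 (q.uc (q.ph Y)))))
    (g3 := q.uc2 (q.uc1 (q.uc (q.uc (q.ph Y)))))
    (h := q.uc2 (q.uc1 (q.uc (q.ph (Ten k H Y)))))
    ?_ ?_ ?_ ?_ ?_ ?_ ?_ ?_ ?_
  · simp only [om, map_mul, map_inv, um_uc1, um_uc, um_ph] at w ⊢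
    have h1 : q.uc2 (q.uc (q.ph (Ten k H (Ten k H Y)))) =
        q.uc (q.uc1 (q.ph (Ten k H (Ten k H Y)))) := (q.uc_uc1 _).symm
    have h2 : q.uc2 (q.uc (q.uc (q.uc2 (q.ph Y)))) = q.uc (q.uc1 (q.uc (q.uc2 (q.ph Y)))) :=
      (q.uc_uc1 _).symm
    rw [h1, h2] at w
    exact w
  · have := congr_arg q.uc (q.ph_uu_comm (q.ph Y))
    simpa only [map_mul, uc_uu] using this
  · have := congr_arg q.uc2 (q.ph_uu_comm (q.ph Y))
    simpa only [map_mul, uc_uu, uc1_uu, uc2_uu] using this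
  · have := congr_arg q.uc2 (q.uc_pentagon (Y := Ten k H (Ten k H Y)))
    simpa only [map_mul, uc_uu, uc1_uu, uc2_uu] using this
  · have := congr_arg q.uc2 (q.uc_nat (q.uc2 (q.ph Y)))
    simpa only [map_mul, uc_uu, uc1_uu, uc2_uu] using this
  · have := congr_arg q.uc2 (q.uc1_nat (q.uc (q.ph Y)))
    simpa only [map_mul, uc_uu, uc1_uu, uc2_uu] using this
  · have := congr_arg q.uc2 (q.uc1_nat (q.ph (Ten k H Y)))
    simpa only [map_mul, uc_uu, uc1_uu, uc2_uu] using this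
  · have := congr_arg (fun t => q.uc2 (q.uc1 t)) (q.uc_nat (q.ph Y))
    simpa only [map_mul, uc_uu, uc1_uu, uc2_uu] using this
  · have := congr_arg (fun t => q.uc2 (q.uc1 t)) (q.uc_pentagon (Y := Ten k H Y))
    simpa only [map_mul, uc_uu, uc1_uu, uc2_uu] using this
  · have := congr_arg (fun t => q.uc2 (q.uc1 (q.uc t))) (q.uc_pentagon (Y := Y))
    simpa only [map_mul, uc_uu, uc1_uu, uc2_uu] using this

/-- The coherence identity behind the compatibility of the Drinfeld twist with `φ`. -/
lemma ww_coherence :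
    ((q.ph (Ten k H (Ten k H (Ten k H Y))))⁻¹ * uu k H (uu k H (uu k H (q.ph Y)))) *
      (um (sh q.cm) (um (sh (sh q.cm)) (q.ww Y)) * uu k H (q.ww (Ten k H Y))) =
    um q.cm (um (sh (sh (sh q.cm))) (q.ww Y)) *
      um (sh (sh q.cm)) (q.uc (q.uc (q.ph Y)) * (q.ph (Ten k H (Ten k H Y)))⁻¹ *
        (q.uc1 (q.ph (Ten k H Y)))⁻¹) := by
  have w := word_twist (q.ph_uu_comm (q.ph Y))
    (q.uc_nat (q.uc1 (q.ph Y)))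
    (K := q.uc (q.uc (q.uc2 (q.ph Y)))) (L := q.uc (q.uc (q.uc (q.ph Y))))
    (B := q.uc1 (q.uc2 (q.ph (Ten k H Y)))) (C := uu k H (q.uc (q.ph (Ten k H Y))))
    (D := uu k H (q.ph (Ten k H (Ten k H Y))))
    (M := q.uc (q.uc (q.ph (Ten k H Y)))) (M' := q.uc1 (q.uc (q.ph (Ten k H Y))))
    (R := q.uc (q.ph (Ten k H (Ten k H Y))))
    (U := q.uc2 (q.uc (q.uc (q.ph Y))))
    (V := q.uc2 (q.ph (Ten k H (Ten k H Y))))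
    (W := q.uc2 (q.uc1 (q.ph (Ten k H Y))))
    (X := q.uc1 (q.uc1 (q.ph (Ten k H Y))))
    (Y := q.uc1 (q.ph (Ten k H (Ten k H Y))))
    ?_ ?_ (q.uc_nat (q.ph (Ten k H Y))) ?_ (q.uc1_nat (q.ph (Ten k H Y))) q.uc_pentagon
  · simp only [ww, map_mul, map_inv, um_uc, um_ph] at w ⊢
    rw [← uc_uc1] at w
    exact w
  · have := congr_arg (fun t => q.uc (q.uc t)) (q.uc_pentagon (Y := Y))
    simpa only [map_mul, uc_uu, uc1_uu, uc2_uu] using this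
  · have := congr_arg q.uc (q.uc_nat (q.ph Y))
    simpa only [map_mul, uc_uc1] using this
  · have := congr_arg q.uc1 (q.uc_pentagon (Y := Ten k H Y))
    simpa only [map_mul, uc_uu, uc1_uu, uc2_uu] using this

end UnitCoherence

section Naturality

variable {k H : Type} [Field k] [Ring H] [Algebra k H] (q : QuasiHopf k H)
variable {Y : Type} [Ring Y] [Algebra k Y]

lemma ph_inv_comm (z : Ten k H Y) :
    (q.ph Y)⁻¹.val * sh q.cm (q.cm z) = q.cm (q.cm z) * (q.ph Y)⁻¹.val := by
  rw [Units.inv_mul_eq_iff_eq_mul, ← mul_assoc, ← cm_coassoc, Units.mul_inv_cancel_right]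

lemma om_val : (q.om Y).val = sh q.cm (q.ph (Ten k H Y)).val *
    sh q.cm (q.cm (q.ph Y)⁻¹.val) * (q.ph (Ten k H (Ten k H Y))).val := rfl

lemma ww_val : (q.ww Y).val = q.cm (q.ph Y).val * (q.ph (Ten k H Y))⁻¹.val := rfl

lemma om_nat (z : Ten k H Y) :
    (q.om Y).val * sh (sh (sh q.cm)) (q.cm (q.cm (q.cm z))) =
      sh q.cm (sh q.cm (q.cm (q.cm z))) * (q.om Y).val := by
  have h1 := q.cm_coassoc (sh q.cm (q.cm z))
  have h2 := congr_arg (fun t => sh q.cm (q.cm t)) (q.ph_inv_comm z)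
  have h3 := congr_arg (sh q.cm) (q.cm_coassoc (q.cm z))
  simp only [map_mul] at h2 h3
  rw [om_val, ← cm_sh, ← cm_sh, mul_assoc, ← h1, ← mul_assoc, mul_assoc (sh q.cm _), h2,
    ← mul_assoc, ← h3, mul_assoc, mul_assoc, mul_assoc]

lemma om_counit : sh (sh (sh q.cu)) (q.cu (q.om Y).val) = 1 := by
  have h : q.cm (q.cu (q.cm (q.ph Y)⁻¹.val)) = q.cm (q.ph Y)⁻¹.val := by rw [cu_cm]
  have h2 : sh (sh q.cu) (q.ph Y)⁻¹.val = 1 := by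
    have := congr_arg (fun t => sh (sh q.cu) t) (q.ph Y).mul_inv
    simpa only [map_mul, sh_sh_cu_ph, one_mul, map_one] using this
  rw [om_val, map_mul q.cu, map_mul q.cu, cu_sh, cu_sh, cu_ph, cu_ph, map_one, one_mul, mul_one, h,
    ← cm_sh, h2, map_one]

lemma ww_nat (z : Ten k H Y) :
    sh (sh q.cm) (q.cm (q.cm z)) * (q.ww Y).val =
      (q.ww Y).val * sh q.cm (q.cm (q.cm z)) := by
  have h := congr_arg q.cm (q.cm_coassoc z)
  simp only [map_mul] at h
  rw [ww_val, ← cm_sh, ← mul_assoc, h, mul_assoc, ← ph_inv_comm, mul_assoc]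

lemma counit_mid_ww : sh (sh q.cu) (q.uc (q.uc (q.ph Y)) * (q.ph (Ten k H (Ten k H Y)))⁻¹ *
    (q.uc1 (q.ph (Ten k H Y)))⁻¹).val = (q.ww Y).val := by
  have h : um (sh (sh q.cu)) (q.uc1 (q.ph (Ten k H Y))) = q.ph (Ten k H Y) :=
    Units.ext (sh_sh_id q.sh_cu_cm _)
  have h1 : um (sh (sh q.cu)) (q.ph (Ten k H (Ten k H Y))) = 1 := Units.ext q.sh_sh_cu_ph
  have h2 : um (sh q.cu) (q.uc (q.ph Y)) = q.ph Y := Units.ext (q.sh_cu_cm _)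
  have h3 : um (sh (sh q.cu)) (q.uc (q.uc (q.ph Y)) * (q.ph (Ten k H (Ten k H Y)))⁻¹ *
    (q.uc1 (q.ph (Ten k H Y)))⁻¹) = q.ww Y := by
    rw [map_mul, map_mul, map_inv, map_inv, h, h1, um_uc, h2, inv_one, mul_one]; rfl
  exact congr_arg Units.val h3

end Naturality

section Actions

set_option linter.unusedSimpArgs false

variable {k H : Type} [Field k] [Ring H] [Algebra k H] (q : QuasiHopf k H)
variable {M N : Type} [AddCommGroup M] [Module k M] [AddCommGroup N] [Module k N]
variable {Y : Type} [Ring Y] [Algebra k Y]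

/-- Left multiplication on the first factor of `H ⊗ M`. -/
def lm : H →ₐ[k] Module.End k (H ⊗[k] M) :=
  AlgHom.ofLinearMap ((LinearMap.rTensorHom M).comp (LinearMap.mul k H))
    (by ext; simp) (by intro x y; ext; simp [mul_assoc])

/-- Right multiplication through the antipode on the first factor of `H ⊗ M`. -/
def rm : H →ₐ[k] Module.End k (H ⊗[k] M) :=
  AlgHom.ofLinearMap ((LinearMap.rTensorHom M).comp ((LinearMap.mul k H).flip.comp q.S))
    (by ext; simp [q.S_one]) (by intro x y; ext; simp [mul_assoc, q.S_mul])

/-- The operator `id ⊗ t` on `H ⊗ M`. -/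
def inn : Module.End k M →ₐ[k] Module.End k (H ⊗[k] M) :=
  AlgHom.ofLinearMap (LinearMap.lTensorHom H)
    (by ext; simp) (by intro x y; ext; simp)

@[simp] lemma lm_tmul (x a : H) (m : M) : lm (k := k) x (a ⊗ₜ[k] m) = (x * a) ⊗ₜ[k] m := rfl

@[simp] lemma rm_tmul (x a : H) (m : M) : q.rm x (a ⊗ₜ[k] m) = (a * q.S x) ⊗ₜ[k] m := rfl

@[simp] lemma inn_tmul (t : Module.End k M) (a : H) (m : M) :
    inn t (a ⊗ₜ[k] m) = a ⊗ₜ[k] t m := rfl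

lemma lm_rm (x y : H) : Commute (lm (k := k) (M := M) x) (q.rm y) := by
  ext; simp [mul_assoc]

lemma lm_inn (x : H) (t : Module.End k M) : Commute (lm (k := k) (M := M) x) (inn t) := by
  ext; simp

lemma inn_rm (x : H) (t : Module.End k M) : Commute (inn t) (q.rm (M := M) x) := by
  ext; simp

lemma inn_inn {s t : Module.End k M} (h : Commute s t) :
    Commute (inn (H := H) s) (inn t) := h.map inn

lemma commute_algLift {E : Type} [Semiring E] [Algebra k E] {a : E} {f : H →ₐ[k] E} {g : Y →ₐ[k] E}
    {h : ∀ x y, Commute (f x) (g y)} (hf : ∀ x, Commute a (f x)) (hg : ∀ y, Commute a (g y))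
    (z : Ten k H Y) : Commute a (algLift f g h z) := by
  induction z using ind with
  | zero => simp
  | pt x y => exact (hf x).mul_right (hg y)
  | add x y hx hy => rw [map_add]; exact hx.add_right hy

/-- Two algebra maps with commuting images. -/
def CommHom {E : Type} [Semiring E] [Algebra k E] (f g : H →ₐ[k] E) : Prop :=
  ∀ x y, Commute (f x) (g y)

lemma commHom_lm_rm : CommHom (lm (k := k) (M := M)) q.rm := q.lm_rm

lemma commHom_lm_inn (f : H →ₐ[k] Module.End k M) : CommHom lm (inn.comp f) :=
  fun x y => lm_inn x (f y)

lemma commHom_inn_rm (f : H →ₐ[k] Module.End k M) : CommHom (inn.comp f) q.rm :=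
  fun x y => q.inn_rm y (f x)

lemma CommHom.inn {f g : H →ₐ[k] Module.End k M} (h : CommHom f g) :
    CommHom (inn.comp f) ((QuasiHopf.inn (H := H)).comp g) :=
  fun x y => inn_inn (h x y)

section Lift

variable {E : Type} [Semiring E] [Algebra k E] {f₁ f₂ f₃ f₄ f₅ f₆ f₇ : H →ₐ[k] E} {a : E}

/-- The algebra map on `H ⊗ k` induced by one on `H`. -/
def lift1 (f₁ : H →ₐ[k] E) : Ten k H k →ₐ[k] E :=
  algLift f₁ (Algebra.ofId k E) fun x c => (Algebra.commutes c (f₁ x)).symm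

@[simp] lemma lift1_pt (f₁ : H →ₐ[k] E) (x : H) (c : k) : lift1 f₁ (pt x c) = c • f₁ x := by
  change f₁ x * algebraMap k E c = _
  rw [← Algebra.commutes, Algebra.smul_def]

lemma commute_lift1 (h : ∀ g ∈ [f₁], ∀ x, Commute a (g x)) (z : Ten k H k) :
    Commute a (lift1 f₁ z) :=
  commute_algLift (h f₁ (by simp)) (g := Algebra.ofId k E) (fun c => (Algebra.commutes c a).symm) z

/-- The algebra map on a tensor power of `H` induced by commuting algebra maps on `H`. -/
def lift2 (f₁ f₂ : H →ₐ[k] E)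
    (h₁ : ∀ g ∈ [f₂], CommHom f₁ g) :
    Ten k H (Ten k H k) →ₐ[k] E :=
  algLift f₁ (lift1 f₂) fun x =>
    commute_lift1 fun g hg => h₁ g hg x

lemma commute_lift2
    {h₁ : ∀ g ∈ [f₂], CommHom f₁ g}
    (h : ∀ g ∈ [f₁, f₂], ∀ x, Commute a (g x)) (z : Ten k H (Ten k H k)) :
    Commute a (lift2 f₁ f₂ h₁ z) :=
  commute_algLift (h f₁ (by simp)) (commute_lift1 fun g hg => h g (by simp [hg])) z

/-- The algebra map on a tensor power of `H` induced by commuting algebra maps on `H`. -/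
def lift3 (f₁ f₂ f₃ : H →ₐ[k] E)
    (h₁ : ∀ g ∈ [f₂, f₃], CommHom f₁ g)
    (h₂ : ∀ g ∈ [f₃], CommHom f₂ g) :
    Ten k H (Ten k H (Ten k H k)) →ₐ[k] E :=
  algLift f₁ (lift2 f₂ f₃ h₂) fun x =>
    commute_lift2 fun g hg => h₁ g hg x

lemma commute_lift3
    {h₁ : ∀ g ∈ [f₂, f₃], CommHom f₁ g}
    {h₂ : ∀ g ∈ [f₃], CommHom f₂ g}
    (h : ∀ g ∈ [f₁, f₂, f₃], ∀ x, Commute a (g x)) (z : Ten k H (Ten k H (Ten k H k))) :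
    Commute a (lift3 f₁ f₂ f₃ h₁ h₂ z) :=
  commute_algLift (h f₁ (by simp)) (commute_lift2 fun g hg => h g (by simp [hg])) z

/-- The algebra map on a tensor power of `H` induced by commuting algebra maps on `H`. -/
def lift4 (f₁ f₂ f₃ f₄ : H →ₐ[k] E)
    (h₁ : ∀ g ∈ [f₂, f₃, f₄], CommHom f₁ g)
    (h₂ : ∀ g ∈ [f₃, f₄], CommHom f₂ g)
    (h₃ : ∀ g ∈ [f₄], CommHom f₃ g) :
    Ten k H (Ten k H (Ten k H (Ten k H k))) →ₐ[k] E :=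
  algLift f₁ (lift3 f₂ f₃ f₄ h₂ h₃) fun x =>
    commute_lift3 fun g hg => h₁ g hg x

lemma commute_lift4
    {h₁ : ∀ g ∈ [f₂, f₃, f₄], CommHom f₁ g}
    {h₂ : ∀ g ∈ [f₃, f₄], CommHom f₂ g}
    {h₃ : ∀ g ∈ [f₄], CommHom f₃ g}
    (h : ∀ g ∈ [f₁, f₂, f₃, f₄], ∀ x, Commute a (g x))
    (z : Ten k H (Ten k H (Ten k H (Ten k H k)))) :
    Commute a (lift4 f₁ f₂ f₃ f₄ h₁ h₂ h₃ z) :=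
  commute_algLift (h f₁ (by simp)) (commute_lift3 fun g hg => h g (by simp [hg])) z

/-- The algebra map on a tensor power of `H` induced by commuting algebra maps on `H`. -/
def lift5 (f₁ f₂ f₃ f₄ f₅ : H →ₐ[k] E)
    (h₁ : ∀ g ∈ [f₂, f₃, f₄, f₅], CommHom f₁ g)
    (h₂ : ∀ g ∈ [f₃, f₄, f₅], CommHom f₂ g)
    (h₃ : ∀ g ∈ [f₄, f₅], CommHom f₃ g)
    (h₄ : ∀ g ∈ [f₅], CommHom f₄ g) :
    Ten k H (Ten k H (Ten k H (Ten k H (Ten k H k)))) →ₐ[k] E :=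
  algLift f₁ (lift4 f₂ f₃ f₄ f₅ h₂ h₃ h₄) fun x =>
    commute_lift4 fun g hg => h₁ g hg x

lemma commute_lift5
    {h₁ : ∀ g ∈ [f₂, f₃, f₄, f₅], CommHom f₁ g}
    {h₂ : ∀ g ∈ [f₃, f₄, f₅], CommHom f₂ g}
    {h₃ : ∀ g ∈ [f₄, f₅], CommHom f₃ g}
    {h₄ : ∀ g ∈ [f₅], CommHom f₄ g}
    (h : ∀ g ∈ [f₁, f₂, f₃, f₄, f₅], ∀ x, Commute a (g x))
    (z : Ten k H (Ten k H (Ten k H (Ten k H (Ten k H k))))) :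
    Commute a (lift5 f₁ f₂ f₃ f₄ f₅ h₁ h₂ h₃ h₄ z) :=
  commute_algLift (h f₁ (by simp)) (commute_lift4 fun g hg => h g (by simp [hg])) z

/-- The algebra map on a tensor power of `H` induced by commuting algebra maps on `H`. -/
def lift6 (f₁ f₂ f₃ f₄ f₅ f₆ : H →ₐ[k] E)
    (h₁ : ∀ g ∈ [f₂, f₃, f₄, f₅, f₆], CommHom f₁ g)
    (h₂ : ∀ g ∈ [f₃, f₄, f₅, f₆], CommHom f₂ g)
    (h₃ : ∀ g ∈ [f₄, f₅, f₆], CommHom f₃ g)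
    (h₄ : ∀ g ∈ [f₅, f₆], CommHom f₄ g)
    (h₅ : ∀ g ∈ [f₆], CommHom f₅ g) :
    Ten k H (Ten k H (Ten k H (Ten k H (Ten k H (Ten k H k))))) →ₐ[k] E :=
  algLift f₁ (lift5 f₂ f₃ f₄ f₅ f₆ h₂ h₃ h₄ h₅) fun x =>
    commute_lift5 fun g hg => h₁ g hg x

lemma commute_lift6
    {h₁ : ∀ g ∈ [f₂, f₃, f₄, f₅, f₆], CommHom f₁ g}
    {h₂ : ∀ g ∈ [f₃, f₄, f₅, f₆], CommHom f₂ g}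
    {h₃ : ∀ g ∈ [f₄, f₅, f₆], CommHom f₃ g}
    {h₄ : ∀ g ∈ [f₅, f₆], CommHom f₄ g}
    {h₅ : ∀ g ∈ [f₆], CommHom f₅ g}
    (h : ∀ g ∈ [f₁, f₂, f₃, f₄, f₅, f₆], ∀ x, Commute a (g x))
    (z : Ten k H (Ten k H (Ten k H (Ten k H (Ten k H (Ten k H k)))))) :
    Commute a (lift6 f₁ f₂ f₃ f₄ f₅ f₆ h₁ h₂ h₃ h₄ h₅ z) :=
  commute_algLift (h f₁ (by simp)) (commute_lift5 fun g hg => h g (by simp [hg])) z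

/-- The algebra map on a tensor power of `H` induced by commuting algebra maps on `H`. -/
def lift7 (f₁ f₂ f₃ f₄ f₅ f₆ f₇ : H →ₐ[k] E)
    (h₁ : ∀ g ∈ [f₂, f₃, f₄, f₅, f₆, f₇], CommHom f₁ g)
    (h₂ : ∀ g ∈ [f₃, f₄, f₅, f₆, f₇], CommHom f₂ g)
    (h₃ : ∀ g ∈ [f₄, f₅, f₆, f₇], CommHom f₃ g)
    (h₄ : ∀ g ∈ [f₅, f₆, f₇], CommHom f₄ g)
    (h₅ : ∀ g ∈ [f₆, f₇], CommHom f₅ g)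
    (h₆ : ∀ g ∈ [f₇], CommHom f₆ g) :
    Ten k H (Ten k H (Ten k H (Ten k H (Ten k H (Ten k H (Ten k H k)))))) →ₐ[k] E :=
  algLift f₁ (lift6 f₂ f₃ f₄ f₅ f₆ f₇ h₂ h₃ h₄ h₅ h₆) fun x =>
    commute_lift6 fun g hg => h₁ g hg x

end Lift

/-- Left multiplication of `H` on itself. -/
def lmul : H →ₐ[k] Module.End k H := Algebra.lmul k H

/-- Right multiplication of `H` on itself, through the antipode. -/
def rmul : H →ₐ[k] Module.End k H :=
  AlgHom.ofLinearMap ((LinearMap.mul k H).flip.comp q.S)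
    (by ext; simp [q.S_one]) (by intro x y; ext; simp [mul_assoc, q.S_mul])

lemma commHom_lmul_rmul : CommHom (k := k) lmul q.rmul := fun x y => by
  ext; simp [lmul, rmul, mul_assoc]

/-- `x₁ ⊗ x₂ ⊗ x₃ ⊗ x₄` acting on `H ⊗ H` by `a ⊗ b ↦ x₁ a S(x₄) ⊗ x₂ b S(x₃)`. -/
def act4 : Ten k H (Ten k H (Ten k H (Ten k H k))) →ₐ[k]
    Module.End k (H ⊗[k] H) :=
  lift4 (lm (M := H)) (inn.comp lmul) (inn.comp q.rmul) q.rm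
    (by simp [commHom_lm_rm, commHom_lm_inn, commHom_inn_rm, CommHom.inn, commHom_lmul_rmul])
    (by simp [commHom_lm_rm, commHom_lm_inn, commHom_inn_rm, CommHom.inn, commHom_lmul_rmul])
    (by simp [commHom_lm_rm, commHom_lm_inn, commHom_inn_rm, CommHom.inn, commHom_lmul_rmul])

variable {V : Type} [AddCommGroup V] [Module k V] (r : H →ₐ[k] Module.End k V)

/-- `x₁ ⊗ x₂ ⊗ x₃` acting on `H ⊗ V` by `a ⊗ v ↦ x₁ a S(x₃) ⊗ x₂ v`. -/
def act3 : Ten k H (Ten k H (Ten k H k)) →ₐ[k]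
    Module.End k (H ⊗[k] V) :=
  lift3 (lm (M := V)) (inn.comp r) q.rm
    (by simp [commHom_lm_rm, commHom_lm_inn, commHom_inn_rm, CommHom.inn, commHom_lmul_rmul])
    (by simp [commHom_lm_rm, commHom_lm_inn, commHom_inn_rm, CommHom.inn, commHom_lmul_rmul])

/-- The action of the fifth tensor power of `H` on `H ⊗ (H ⊗ V)`: the outer legs act on the outer
factors, those on the left by left multiplication and those on the right by right multiplication
through the antipode. -/
def act5 : Ten k H (Ten k H (Ten k H (Ten k H (Ten k H k)))) →ₐ[k]
    Module.End k (H ⊗[k] (H ⊗[k] V)) :=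
  lift5 (lm (M := H ⊗[k] V)) (inn.comp lm) (inn.comp (inn.comp r)) (inn.comp q.rm) q.rm
    (by simp [commHom_lm_rm, commHom_lm_inn, commHom_inn_rm, CommHom.inn, commHom_lmul_rmul])
    (by simp [commHom_lm_rm, commHom_lm_inn, commHom_inn_rm, CommHom.inn, commHom_lmul_rmul])
    (by simp [commHom_lm_rm, commHom_lm_inn, commHom_inn_rm, CommHom.inn, commHom_lmul_rmul])
    (by simp [commHom_lm_rm, commHom_lm_inn, commHom_inn_rm, CommHom.inn, commHom_lmul_rmul])

/-- The action of the seventh tensor power of `H` on `H ⊗ (H ⊗ (H ⊗ V))`, with the legs ordered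
as for `act5`. -/
def act7 : Ten k H (Ten k H (Ten k H (Ten k H (Ten k H (Ten k H (Ten k H k)))))) →ₐ[k]
    Module.End k (H ⊗[k] (H ⊗[k] (H ⊗[k] V))) :=
  lift7 (lm (M := H ⊗[k] (H ⊗[k] V))) (inn.comp lm) (inn.comp (inn.comp lm))
    (inn.comp (inn.comp (inn.comp r)))
    (inn.comp (inn.comp q.rm)) (inn.comp q.rm) q.rm
    (by simp [commHom_lm_rm, commHom_lm_inn, commHom_inn_rm, CommHom.inn, commHom_lmul_rmul])
    (by simp [commHom_lm_rm, commHom_lm_inn, commHom_inn_rm, CommHom.inn, commHom_lmul_rmul])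
    (by simp [commHom_lm_rm, commHom_lm_inn, commHom_inn_rm, CommHom.inn, commHom_lmul_rmul])
    (by simp [commHom_lm_rm, commHom_lm_inn, commHom_inn_rm, CommHom.inn, commHom_lmul_rmul])
    (by simp [commHom_lm_rm, commHom_lm_inn, commHom_inn_rm, CommHom.inn, commHom_lmul_rmul])
    (by simp [commHom_lm_rm, commHom_lm_inn, commHom_inn_rm, CommHom.inn, commHom_lmul_rmul])

end Actions

namespace Ten

variable {k H : Type} [Field k] [Ring H] [Algebra k H]

@[elab_as_elim] lemma ind_one {p : Ten k H k → Prop} (z : Ten k H k)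
    (pt : ∀ x, p (pt x 1)) (add : ∀ x y, p x → p y → p (x + y)) : p z := by
  induction z using ind with
  | zero => simpa [Ten.pt] using pt 0
  | pt x c =>
    have : (Ten.pt x c : Ten k H k) = Ten.pt (c • x) 1 := by
      rw [smul_pt, ← pt_smul, smul_eq_mul, mul_one]
    rw [this]; exact pt _
  | add x y hx hy => exact add x y hx hy

@[elab_as_elim] lemma ind_succ {Y : Type} [Ring Y] [Algebra k Y] {s : Y → Prop}
    (hs : ∀ p' : Y → Prop, (∀ y, s y → p' y) → (∀ x y, p' x → p' y → p' (x + y)) → ∀ y, p' y)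
    {p : Ten k H Y → Prop} (z : Ten k H Y)
    (pt : ∀ x y, s y → p (pt x y)) (add : ∀ x y, p x → p y → p (x + y)) : p z := by
  have key : ∀ x y, p (Ten.pt x y) := fun x => hs _ (pt x) fun y y' hy hy' => by
    rw [pt_add]; exact add _ _ hy hy'
  induction z using ind with
  | zero => simpa [Ten.pt] using key 0 0
  | pt x y => exact key x y
  | add x y hx hy => exact add x y hx hy

@[elab_as_elim] lemma ind_two {p : Ten k H (Ten k H k) → Prop} (z : Ten k H (Ten k H k))
    (pt : ∀ x y, p (pt x (.pt y 1))) (add : ∀ x y, p x → p y → p (x + y)) : p z :=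
  ind_succ (s := fun w => ∃ y, w = Ten.pt y 1)
    (fun _ h hadd w => ind_one w (fun y => h _ ⟨y, rfl⟩) hadd) z
    (by rintro x _ ⟨y, rfl⟩; exact pt x y) add

@[elab_as_elim] lemma ind_three {p : Ten k H (Ten k H (Ten k H k)) → Prop}
    (z : Ten k H (Ten k H (Ten k H k)))
    (pt : ∀ x y t, p (pt x (.pt y (.pt t 1)))) (add : ∀ x y, p x → p y → p (x + y)) : p z :=
  ind_succ (s := fun w => ∃ y t, w = Ten.pt y (Ten.pt t 1))
    (fun _ h hadd w => ind_two w (fun y t => h _ ⟨y, t, rfl⟩) hadd) z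
    (by rintro x _ ⟨y, t, rfl⟩; exact pt x y t) add

@[elab_as_elim] lemma ind_four {p : Ten k H (Ten k H (Ten k H (Ten k H k))) → Prop}
    (z : Ten k H (Ten k H (Ten k H (Ten k H k))))
    (pt : ∀ x y t u, p (pt x (.pt y (.pt t (.pt u 1)))))
    (add : ∀ x y, p x → p y → p (x + y)) : p z :=
  ind_succ (s := fun w => ∃ y t u, w = Ten.pt y (Ten.pt t (Ten.pt u 1)))
    (fun _ h hadd w => ind_three w (fun y t u => h _ ⟨y, t, u, rfl⟩) hadd) z
    (by rintro x _ ⟨y, t, u, rfl⟩; exact pt x y t u) add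

@[elab_as_elim] lemma ind_five {p : Ten k H (Ten k H (Ten k H (Ten k H (Ten k H k)))) → Prop}
    (z : Ten k H (Ten k H (Ten k H (Ten k H (Ten k H k)))))
    (pt : ∀ x y t u w, p (pt x (.pt y (.pt t (.pt u (.pt w 1))))))
    (add : ∀ x y, p x → p y → p (x + y)) : p z :=
  ind_succ (s := fun w => ∃ y t u r, w = Ten.pt y (Ten.pt t (Ten.pt u (Ten.pt r 1))))
    (fun _ h hadd w => ind_four w (fun y t u r => h _ ⟨y, t, u, r, rfl⟩) hadd) z
    (by rintro x _ ⟨y, t, u, r, rfl⟩; exact pt x y t u r) add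

variable {A Y : Type} [AddCommGroup A] [Module k A] [Ring Y] [Algebra k Y]

/-- The linear map `x ⊗ y ↦ l x (g y)`. -/
def comb (l : H →ₗ[k] Module.End k A) (g : Y →ₗ[k] A) : Ten k H Y →ₗ[k] A :=
  linLift ((LinearMap.lcomp k A g).comp l)

@[simp] lemma comb_pt (l : H →ₗ[k] Module.End k A) (g : Y →ₗ[k] A) (x : H) (y : Y) :
    comb l g (pt x y) = l x (g y) := rfl

end Ten

section Twist

variable {k H : Type} [Field k] [Ring H] [Algebra k H] (q : QuasiHopf k H)

@[simp] lemma act4_pt (x y t u : H) (c : k) (a b : H) :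
    q.act4 (pt x (pt y (pt t (pt u c)))) (a ⊗ₜ[k] b) =
      c • (x * a * q.S u) ⊗ₜ[k] (y * b * q.S t) := by
  simp [act4, lift4, lift3, lift2, lmul, rmul, mul_assoc, Module.End.mul_apply]

lemma scop_eq (x : H) : q.scop x = q.sswap (q.comul x) := by
  simp [scop, sswap, comul_eq]

lemma sswap_mul (s t : H ⊗[k] H) : q.sswap (s * t) = q.sswap t * q.sswap s := by
  induction s with
  | zero => simp
  | add s s' hs hs' => simp [add_mul, mul_add, hs, hs']
  | tmul a b =>
    induction t with
    | zero => simp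
    | add s s' hs hs' => simp [add_mul, mul_add, hs, hs']
    | tmul c d => simp [sswap, q.S_mul]

lemma scop_mul (x y : H) : q.scop (x * y) = q.scop y * q.scop x := by
  simp [scop_eq, sswap_mul]

lemma scop_one : q.scop 1 = 1 := by
  simp [scop_eq, sswap, Algebra.TensorProduct.one_def, q.S_one]

/-- `scop` as a linear map. -/
def scopLin : H →ₗ[k] H ⊗[k] H := q.sswap.comp q.comul.toLinearMap

@[simp] lemma scopLin_apply (x : H) : q.scopLin x = q.scop x := (q.scop_eq x).symm

lemma act4_comul_scop (x y : H) (t : H ⊗[k] H) :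
    q.act4 (sh (sh q.cm) (q.cm (pt x (pt y 1)))) t = q.comul x * t * q.scop y := by
  induction t with
  | zero => simp
  | add s s' hs hs' => simp only [map_add, add_mul, mul_add, hs, hs']
  | tmul a b =>
    simp [cm_pt, pt_sum, comul_eq, scop, Finset.sum_mul, Finset.mul_sum, LinearMap.sum_apply,
      mul_assoc]
    exact Finset.sum_comm

lemma act4_absorb_inner (u : Ten k H (Ten k H (Ten k H k))) :
    q.act4 (sh q.cm u) (q.beta ⊗ₜ q.beta) =
      q.act4 (sh ((un.comp un).comp q.cu) u) (q.beta ⊗ₜ q.beta) := by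
  induction u using ind_three with
  | add x y hx hy => simp only [map_add, LinearMap.add_apply, hx, hy]
  | pt x y t =>
    simp [cm_pt, pt_sum, LinearMap.sum_apply, pt_smul, un_apply, ← TensorProduct.tmul_sum,
      q.antipode_beta, q.S_one]

lemma bEl_eq : q.bEl = q.act4 (q.ww k).val (q.beta ⊗ₜ q.beta) := by
  simp only [ww_val, ph_val, ph_inv_val, map_sum, cm_pt, Finset.sum_mul, Finset.mul_sum, pt_mul,
    LinearMap.sum_apply, mul_one, ← pt_one, act4_pt, bEl, one_smul]
  rw [Finset.sum_comm]

lemma bEl_absorb (h : H) :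
    ∑ i ∈ Finset.range (q.n h), q.comul (q.d1 h i) * q.bEl * q.scop (q.d2 h i) =
      q.counit h • q.bEl := by
  simp only [← act4_comul_scop, bEl_eq]
  have h1 := congr_arg (fun z => q.act4 z (q.beta ⊗ₜ q.beta)) (q.ww_nat (pt h (1 : k)))
  simp only [map_mul, Module.End.mul_apply, act4_absorb_inner, ← sh_sh] at h1
  rw [sh_cu_cm, q.cm_pt h, map_sum, map_sum, map_sum, LinearMap.sum_apply] at h1
  rw [h1]
  simp [un_apply, LinearMap.sum_apply, q.S_one, ← TensorProduct.sum_tmul, q.antipode_beta,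
    ← TensorProduct.smul_tmul']

/-- `x ⊗ y ⊗ z ↦ Δ(S(x) α y) 𝕓 (S ⊗ S)(Δ^cop z)` -/
def twm : Ten k H (Ten k H (Ten k H k)) →ₗ[k] H ⊗[k] H :=
  comb ((LinearMap.mul k (H ⊗[k] H)).comp (q.comul.toLinearMap.comp
      ((LinearMap.mulRight k q.alpha).comp q.S)))
    (comb ((LinearMap.mul k (H ⊗[k] H)).comp q.comul.toLinearMap)
      (comb ((LinearMap.mul k (H ⊗[k] H)).flip.comp q.scopLin)
        (LinearMap.toSpanSingleton k (H ⊗[k] H) q.bEl)))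

@[simp] lemma twm_pt (x y z : H) (c : k) : q.twm (pt x (pt y (pt z c))) =
    c • (q.comul (q.S x * q.alpha * y) * q.bEl * q.scop z) := by
  simp [twm, mul_assoc]

lemma twistInv_eq : q.twistInv = q.twm (q.ph k)⁻¹.val := by
  simp [ph_inv_val, twistInv, qL1, qL2]

lemma twm_mul_head (w : Ten k H (Ten k H (Ten k H k))) (h : H) :
    q.twm (w * pt h 1) = q.comul (q.S h) * q.twm w := by
  induction w using ind_three with
  | add x y hx hy => simp only [map_add, add_mul, mul_add, hx, hy]
  | pt x y z => simp [pt_mul, q.S_mul, mul_assoc]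

lemma twm_mul_last (w : Ten k H (Ten k H (Ten k H k))) (h : H) :
    q.twm (un (un (pt h 1)) * w) = q.twm w * q.scop h := by
  induction w using ind_three with
  | add x y hx hy => simp only [map_add, add_mul, mul_add, hx, hy]
  | pt x y z => simp [un_apply, pt_mul, q.scop_mul, mul_assoc]

lemma twm_absorb_right (w : Ten k H (Ten k H (Ten k H k))) (u : Ten k H (Ten k H k)) :
    q.twm (w * sh q.cm u) = q.twm (w * sh ((un.comp un).comp q.cu) u) := by
  induction u using ind_two with
  | add x y hx hy => simp only [map_add, mul_add, hx, hy]
  | pt x' y' =>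
    induction w using ind_three with
    | add x y hx hy => simp only [map_add, add_mul, hx, hy]
    | pt x y z =>
      have h := congr_arg (fun t => q.comul (q.S (x * x') * q.alpha * y) * t * q.scop z)
        (q.bEl_absorb y')
      simp only [Finset.mul_sum, Finset.sum_mul] at h
      simp [un_apply, cm_pt, pt_mul, pt_sum, Finset.mul_sum, q.scop_mul]
      simpa [mul_assoc] using h

lemma twm_absorb_left (w : Ten k H (Ten k H (Ten k H k))) (u : Ten k H (Ten k H k)) :
    q.twm (q.cm u * w) = q.twm (un (un (q.cu u)) * w) := by
  induction u using ind_two with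
  | add x y hx hy => simp only [map_add, add_mul, hx, hy]
  | pt x' y' =>
    induction w using ind_three with
    | add x y hx hy => simp only [map_add, mul_add, hx, hy]
    | pt x y z =>
      have h := congr_arg (fun t => q.comul (q.S x * t * y) * q.bEl * q.scop (y' * z))
        (q.antipode_alpha x')
      simp only [Finset.mul_sum, Finset.sum_mul, map_sum] at h
      simp [un_apply, cm_pt, pt_mul, Finset.sum_mul, q.S_mul]
      simpa [mul_assoc] using h

lemma comul_S_mul_twistInv (h : H) :
    q.comul (q.S h) * q.twistInv = q.twistInv * q.scop h := by
  have h1 := congr_arg q.twm (q.ph_inv_comm (pt h (1 : k)))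
  rw [twm_absorb_right, twm_absorb_left, cu_cm, twm_mul_last, ← sh_sh, sh_cu_cm, sh_pt, map_one,
    twm_mul_head, ← twistInv_eq] at h1
  exact h1

/-- `x ⊗ w ↦ Δ(x β) twm(w)` -/
def twn : Ten k H (Ten k H (Ten k H (Ten k H k))) →ₗ[k] H ⊗[k] H :=
  comb ((LinearMap.mul k (H ⊗[k] H)).comp (q.comul.toLinearMap.comp
      (LinearMap.mulRight k q.beta))) q.twm

lemma twn_pt (x : H) (w : Ten k H (Ten k H (Ten k H k))) :
    q.twn (pt x w) = q.comul (x * q.beta) * q.twm w := rfl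

lemma twn_absorb_head (w : Ten k H (Ten k H (Ten k H (Ten k H k))))
    (u : Ten k H (Ten k H (Ten k H k))) :
    q.twn (w * q.cm u) = q.twn (w * un (un (q.cu u))) := by
  induction u using ind with
  | zero => simp
  | add x y hx hy => simp only [map_add, mul_add, hx, hy]
  | pt x' v =>
    induction w using ind_four with
    | add x y hx hy => simp only [map_add, add_mul, hx, hy]
    | pt x y z t =>
      obtain ⟨g, hg⟩ : ∃ g : Ten k H (Ten k H k) →ₗ[k] H ⊗[k] H, ∀ b v,
          q.twm (pt b v) = q.comul (q.S b) * g v :=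
        ⟨q.twm.comp un.toLinearMap, fun b v => by simp [← twm_mul_head, un_apply, pt_mul]⟩
      have h := congr_arg (fun s => q.comul (x * s * q.S y) * g (pt z (pt t 1) * v))
        (q.antipode_beta x')
      simp only [Finset.mul_sum, Finset.sum_mul, map_sum] at h
      simp [un_apply, cm_pt, pt_mul, Finset.mul_sum, twn_pt, hg, q.S_mul]
      simpa [mul_assoc] using h

lemma twn_absorb_mid (w : Ten k H (Ten k H (Ten k H (Ten k H k))))
    (u : Ten k H (Ten k H (Ten k H k))) :
    q.twn (sh q.cm u * w) = q.twn (sh ((un.comp un).comp q.cu) u * w) := by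
  induction u using ind with
  | zero => simp
  | add x y hx hy => simp only [map_add, add_mul, hx, hy]
  | pt x' v =>
    induction w using ind with
    | zero => simp
    | add x y hx hy => simp only [map_add, mul_add, hx, hy]
    | pt x y => simp [pt_mul, twn_pt, twm_absorb_left]

lemma twn_absorb_last (w : Ten k H (Ten k H (Ten k H (Ten k H k))))
    (u : Ten k H (Ten k H (Ten k H k))) :
    q.twn (w * sh (sh q.cm) u) = q.twn (w * sh (sh ((un.comp un).comp q.cu)) u) := by
  induction u using ind with
  | zero => simp
  | add x y hx hy => simp only [map_add, mul_add, hx, hy]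
  | pt x' v =>
    induction w using ind with
    | zero => simp
    | add x y hx hy => simp only [map_add, add_mul, hx, hy]
    | pt x y => simp only [sh_pt, pt_mul, twn_pt, twm_absorb_right]

lemma cu_ph_inv {Y : Type} [Ring Y] [Algebra k Y] : q.cu (q.ph Y)⁻¹.val = 1 := by
  simpa only [map_mul, cu_ph, one_mul, map_one] using congr_arg q.cu (q.ph Y).mul_inv

lemma sh_sh_cu_ph_inv {Y : Type} [Ring Y] [Algebra k Y] :
    sh (sh q.cu) (q.ph Y)⁻¹.val = 1 := by
  simpa only [map_mul, sh_sh_cu_ph, one_mul, map_one] using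
    congr_arg (sh (sh q.cu)) (q.ph Y).mul_inv

lemma comul_beta_mul_twistInv : q.comul q.beta * q.twistInv = q.bEl := by
  have h1 : un (q.ph k)⁻¹.val = sh q.cm (q.ph k).val * ((q.ph (Ten k H k)).val *
      q.cm (q.ph k)⁻¹.val * sh (sh q.cm) (q.ph k)⁻¹.val) := by
    have h := congr_arg (fun z => un (q.ph k)⁻¹.val * z * (q.cm (q.ph k)⁻¹.val *
      sh (sh q.cm) (q.ph k)⁻¹.val)) (q.ph_pentagon (Y := k))
    have h2 : (un (q.ph k)⁻¹.val : Ten k H _) * un (q.ph k).val = 1 := by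
      rw [← map_mul, Units.inv_mul, map_one]
    have h3 : q.cm (q.ph k).val * q.cm (q.ph k)⁻¹.val = 1 := by
      rw [← map_mul, Units.mul_inv, map_one]
    have h4 : sh (sh q.cm) (q.ph k).val * sh (sh q.cm) (q.ph k)⁻¹.val = 1 := by
      rw [← map_mul, Units.mul_inv, map_one]
    simp only [mul_assoc] at h
    rw [← mul_assoc (q.cm _) (q.cm _), h3, one_mul, h4, mul_one, ← mul_assoc (un _) (un _), h2,
      one_mul] at h
    simpa only [mul_assoc] using h
  have h5 := congr_arg q.twn h1
  rw [twn_absorb_mid, ← sh_sh, sh_cu_ph, map_one, one_mul, twn_absorb_last, sh_sh_comp,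
    sh_sh_cu_ph_inv, map_one, mul_one, twn_absorb_head, cu_ph_inv, map_one, map_one, mul_one,
    un_apply, twn_pt, one_mul, ← twistInv_eq] at h5
  have h6 := congr_arg (fun t => q.comul t * q.bEl) q.nondeg_1
  simp only [map_sum, Finset.sum_mul, map_one, one_mul] at h6
  rw [h5, ph_val, map_sum, ← h6]
  simp [twn_pt, ← pt_one, scop_one, mul_assoc]

lemma counit_S (h : H) : q.counit (q.S h) = q.counit h := by
  have h1 := congr_arg q.counit (q.antipode_alpha h)
  simp only [map_sum, map_mul, q.counit_alpha, mul_one, map_smul, smul_eq_mul] at h1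
  rw [← h1]
  conv_lhs => rw [← q.counit_right h]
  simp [mul_comm]

/-- `ε ⊗ id` on `H ⊗ M`. -/
def hd {M : Type} [AddCommGroup M] [Module k M] : H ⊗[k] M →ₗ[k] M :=
  (TensorProduct.lid k M).toLinearMap.comp (TensorProduct.map q.counit.toLinearMap LinearMap.id)

@[simp] lemma hd_tmul {M : Type} [AddCommGroup M] [Module k M] (a : H) (m : M) :
    q.hd (a ⊗ₜ m) = q.counit a • m := by
  simp [hd]

lemma hd_mul (s t : H ⊗[k] H) : q.hd (s * t) = q.hd s * q.hd t := by
  induction s with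
  | zero => simp
  | add s s' hs hs' => simp [add_mul, hs, hs']
  | tmul a b =>
    induction t with
    | zero => simp
    | add s s' hs hs' => simp [mul_add, hs, hs']
    | tmul c d => simp [smul_smul]; ring_nf

lemma hd_comul (x : H) : q.hd (q.comul x) = x := by
  simp [comul_eq, q.counit_left]

lemma hd_scop (x : H) : q.hd (q.scop x) = q.S x := by
  conv_rhs => rw [← q.counit_right x]
  simp [scop, counit_S]

lemma hd_act4 (z : Ten k H (Ten k H (Ten k H (Ten k H k)))) (t : H ⊗[k] H) :
    q.hd (q.act4 z t) =
      lift2 lmul q.rmul (by simp [commHom_lmul_rmul]) (sh (sh q.cu) (q.cu z)) (q.hd t) := by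
  induction z using ind_four with
  | add x y hx hy => simp only [map_add, LinearMap.add_apply, hx, hy]
  | pt x y z u =>
    induction t with
    | zero => simp
    | add s s' hs hs' => simp only [map_add, hs, hs']
    | tmul a b =>
      simp [lift2, lmul, rmul, counit_S, smul_smul, mul_comm, mul_left_comm]
      rw [mul_assoc]

lemma hd_bEl : q.hd q.bEl = q.beta := by
  rw [bEl_eq, hd_act4, ww_val, map_mul, cu_cm, cu_ph_inv, mul_one, sh_sh_cu_ph, map_one]
  simp [q.counit_beta]

lemma hd_twistInv : q.hd q.twistInv = 1 := by
  simp [twistInv, hd_mul, hd_bEl, hd_comul, hd_scop, qL1, qL2, q.nondeg_2]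

end Twist

section Theta

variable {k H : Type} [Field k] [Ring H] [Algebra k H] (q : QuasiHopf k H)
variable {M N V : Type} [AddCommGroup M] [Module k M] [AddCommGroup N] [Module k N]
  [AddCommGroup V] [Module k V] (r : H →ₐ[k] Module.End k V)

lemma act3_pt (x y t : H) (c : k) (m : H ⊗[k] V) :
    q.act3 r (pt x (pt y (pt t c))) m = lm x (inn (r y) (q.rm t (c • m))) := by
  simp [act3, lift3, lift2]

lemma act5_pt (x y t u w : H) (c : k) (m : H ⊗[k] (H ⊗[k] V)) :
    q.act5 r (pt x (pt y (pt t (pt u (pt w c))))) m =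
      lm x (inn (lm y) (inn (inn (r t)) (inn (q.rm u) (q.rm w (c • m))))) := by
  simp [act5, lift5, lift4, lift3, lift2]

lemma act7_pt (x₁ x₂ x₃ x₄ x₅ x₆ x₇ : H) (c : k) (m : H ⊗[k] (H ⊗[k] (H ⊗[k] V))) :
    q.act7 r (pt x₁ (pt x₂ (pt x₃ (pt x₄ (pt x₅ (pt x₆ (pt x₇ c))))))) m =
      lm x₁ (inn (lm x₂) (inn (inn (lm x₃)) (inn (inn (inn (r x₄)))
        (inn (inn (q.rm x₅)) (inn (q.rm x₆) (q.rm x₇ (c • m))))))) := by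
  simp [act7, lift7, lift6, lift5, lift4, lift3, lift2]

/-- The map `a ⊗ m ↦ a₍₁₎ f̄1 ⊗ (a₍₂₎ f̄2 ⊗ m)`. -/
def th : H ⊗[k] M →ₗ[k] H ⊗[k] (H ⊗[k] M) :=
  (TensorProduct.assoc k H H M).toLinearMap ∘ₗ
    LinearMap.rTensor M ((LinearMap.mulRight k q.twistInv).comp q.comul.toLinearMap)

lemma th_tmul (a : H) (m : M) :
    q.th (a ⊗ₜ m) = TensorProduct.assoc k H H M ((q.comul a * q.twistInv) ⊗ₜ m) := rfl

lemma assoc_mul_left (x y : H) (t : H ⊗[k] H) (m : M) :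
    TensorProduct.assoc k H H M (((x ⊗ₜ y) * t) ⊗ₜ m) =
      lm x (inn (lm y) (TensorProduct.assoc k H H M (t ⊗ₜ m))) := by
  induction t with
  | zero => simp
  | add s s' hs hs' => simp only [mul_add, TensorProduct.add_tmul, map_add, hs, hs']
  | tmul a b => simp

lemma assoc_mul_right (x y : H) (t : H ⊗[k] H) (m : M) :
    TensorProduct.assoc k H H M ((t * (q.S x ⊗ₜ q.S y)) ⊗ₜ m) =
      inn (q.rm y) (q.rm x (TensorProduct.assoc k H H M (t ⊗ₜ m))) := by
  induction t with
  | zero => simp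
  | add s s' hs hs' => simp only [add_mul, TensorProduct.add_tmul, map_add, hs, hs']
  | tmul a b => simp

lemma assoc_inn (g : Module.End k M) (t : H ⊗[k] H) (m : M) :
    TensorProduct.assoc k H H M (t ⊗ₜ g m) =
      inn (inn g) (TensorProduct.assoc k H H M (t ⊗ₜ m)) := by
  induction t with
  | zero => simp
  | add s s' hs hs' => simp only [TensorProduct.add_tmul, map_add, hs, hs']
  | tmul a b => simp

lemma th_lm (x : H) (m : H ⊗[k] M) : q.th (lm x m) =
    ∑ i ∈ Finset.range (q.n x), lm (q.d1 x i) (inn (lm (q.d2 x i)) (q.th m)) := by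
  induction m with
  | zero => simp
  | add s s' hs hs' => simp only [map_add, hs, hs', Finset.sum_add_distrib]
  | tmul a b =>
    rw [lm_tmul, th_tmul, map_mul, mul_assoc, q.comul_eq x, Finset.sum_mul,
      TensorProduct.sum_tmul, map_sum]
    simp only [assoc_mul_left, th_tmul]

lemma th_rm (x : H) (m : H ⊗[k] M) : q.th (q.rm x m) =
    ∑ i ∈ Finset.range (q.n x), inn (q.rm (q.d1 x i)) (q.rm (q.d2 x i) (q.th m)) := by
  induction m with
  | zero => simp
  | add s s' hs hs' => simp only [map_add, hs, hs', Finset.sum_add_distrib]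
  | tmul a b =>
    rw [rm_tmul, th_tmul, map_mul, mul_assoc, comul_S_mul_twistInv, ← mul_assoc, scop,
      Finset.mul_sum, TensorProduct.sum_tmul, map_sum]
    simp only [assoc_mul_right, th_tmul]

lemma th_inn (g : Module.End k M) (m : H ⊗[k] M) : q.th (inn g m) = inn (inn g) (q.th m) := by
  induction m with
  | zero => simp
  | add s s' hs hs' => simp only [map_add, hs, hs']
  | tmul a b => rw [inn_tmul, th_tmul, assoc_inn, th_tmul]

lemma lTensor_lm (g : M →ₗ[k] N) (x : H) (m : H ⊗[k] M) :
    g.lTensor H (lm x m) = lm x (g.lTensor H m) := by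
  induction m with
  | zero => simp
  | add s s' hs hs' => simp only [map_add, hs, hs']
  | tmul a b => simp

lemma lTensor_rm (g : M →ₗ[k] N) (x : H) (m : H ⊗[k] M) :
    g.lTensor H (q.rm x m) = q.rm x (g.lTensor H m) := by
  induction m with
  | zero => simp
  | add s s' hs hs' => simp only [map_add, hs, hs']
  | tmul a b => simp

lemma lTensor_inn {g : M →ₗ[k] N} {s : Module.End k M} {t : Module.End k N}
    (h : ∀ m, g (s m) = t (g m)) (m : H ⊗[k] M) :
    g.lTensor H (inn s m) = inn t (g.lTensor H m) := by
  induction m with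
  | zero => simp
  | add s s' hs hs' => simp only [map_add, hs, hs']
  | tmul a b => simp [h]

lemma th_act3 (z : Ten k H (Ten k H (Ten k H k))) (m : H ⊗[k] V) :
    q.th (q.act3 r z m) = q.act5 r (sh (sh (sh q.cm)) (q.cm z)) (q.th m) := by
  induction z using ind_three with
  | add x y hx hy => simp only [map_add, LinearMap.add_apply, hx, hy]
  | pt x y t =>
    simp only [act3_pt, th_lm, th_inn, th_rm, cm_pt, pt_sum, map_sum, sh_pt, LinearMap.sum_apply,
      act5_pt, one_smul]

lemma th_act5 (z : Ten k H (Ten k H (Ten k H (Ten k H (Ten k H k))))) (m : H ⊗[k] (H ⊗[k] V)) :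
    q.th (q.act5 r z m) = q.act7 r (q.cm (sh (sh (sh (sh q.cm))) z)) (q.th m) := by
  induction z using ind_five with
  | add x y hx hy => simp only [map_add, LinearMap.add_apply, hx, hy]
  | pt x y t u w =>
    simp only [act5_pt, th_lm, th_inn, th_rm, cm_pt, pt_sum, map_sum, sh_pt, LinearMap.sum_apply,
      act7_pt, one_smul]
    exact Finset.sum_comm

lemma lTensor_th_act5 (z : Ten k H (Ten k H (Ten k H (Ten k H (Ten k H k)))))
    (m : H ⊗[k] (H ⊗[k] V)) :
    q.th.lTensor H (q.act5 r z m) =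
      q.act7 r (sh q.cm (sh (sh (sh q.cm)) z)) (q.th.lTensor H m) := by
  have h1 (x : H) : ∀ m : H ⊗[k] V, q.th (lm x m) =
    (∑ i ∈ Finset.range (q.n x), lm (q.d1 x i) * inn (lm (q.d2 x i)) :
      Module.End k (H ⊗[k] (H ⊗[k] V))) (q.th m) := by
    simp [th_lm, LinearMap.sum_apply]
  have h2 (x : H) : ∀ m : H ⊗[k] V, q.th (q.rm x m) =
    (∑ i ∈ Finset.range (q.n x), inn (q.rm (q.d1 x i)) * q.rm (q.d2 x i) :
      Module.End k (H ⊗[k] (H ⊗[k] V))) (q.th m) := by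
    simp [th_rm, LinearMap.sum_apply]
  induction z using ind_five with
  | add x y hx hy => simp only [map_add, LinearMap.add_apply, hx, hy]
  | pt x y t u w =>
    simp only [act5_pt, lTensor_lm, lTensor_rm, lTensor_inn (h1 _), lTensor_inn (h2 _),
      lTensor_inn (q.th_inn (r t)), cm_pt, pt_sum, map_sum, sh_pt, LinearMap.sum_apply,
      act7_pt, one_smul, map_mul, Module.End.mul_apply]

lemma inn_act5 (z : Ten k H (Ten k H (Ten k H (Ten k H (Ten k H k))))) :
    inn (q.act5 r z) = q.act7 r (un (sh (sh (sh (sh (sh un)))) z)) := by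
  induction z using ind_five with
  | add x y hx hy => simp only [map_add, hx, hy]
  | pt x y t u w =>
    ext a b
    simp [act5_pt, act7_pt, un_apply]

/-- The algebra map `x ↦ x ⊗ 1`. -/
def hl : H →ₐ[k] Ten k H k := of.toAlgHom.comp Algebra.TensorProduct.includeLeft

lemma hl_apply (x : H) : (hl x : Ten k H k) = pt x 1 := rfl

/-- The action `h · (a ⊗ v) = h₍₁,₁₎ a S(h₍₂₎) ⊗ h₍₁,₂₎ v` as an algebra map. -/
def ra : H →ₐ[k] Module.End k (H ⊗[k] V) :=
  (q.act3 r).comp (q.cm.comp (q.cm.comp hl))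

lemma act3_ra (z : Ten k H (Ten k H (Ten k H k))) :
    q.act3 (q.ra r) z = q.act5 r (sh q.cm (sh q.cm z)) := by
  induction z using ind_three with
  | add x y hx hy => simp only [map_add, hx, hy]
  | pt x y t =>
    ext a b c
    simp [act3_pt, act5_pt, ra, hl_apply, cm_pt, pt_sum, LinearMap.sum_apply]

lemma act5_ra (z : Ten k H (Ten k H (Ten k H (Ten k H (Ten k H k))))) :
    q.act5 (q.ra r) z = q.act7 r (sh (sh q.cm) (sh (sh q.cm) z)) := by
  induction z using ind_five with
  | add x y hx hy => simp only [map_add, hx, hy]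
  | pt x y t u w =>
    ext a b c d
    simp [act3_pt, act5_pt, act7_pt, ra, hl_apply, cm_pt, pt_sum, LinearMap.sum_apply]

end Theta

section Insertion

variable {k H : Type} [Field k] [Ring H] [Algebra k H] (q : QuasiHopf k H)
variable {Y Y' : Type} [Ring Y] [Algebra k Y] [Ring Y'] [Algebra k Y']

lemma sh_ph_inv (g : Y →ₐ[k] Y') : sh (sh (sh g)) (q.ph Y)⁻¹.val = (q.ph Y')⁻¹.val := by
  simp [ph_inv_val]

lemma sh_om (g : Y →ₐ[k] Y') : sh (sh (sh (sh (sh g)))) (q.om Y).val = (q.om Y').val := by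
  have h1 (z : Ten k H (Ten k H (Ten k H (Ten k H Y)))) :
      sh (sh (sh (sh (sh g)))) (sh q.cm z) = sh q.cm (sh (sh (sh (sh g))) z) :=
    sh_sh_congr (fun y => (q.cm_sh (sh (sh g)) y).symm) z
  rw [om_val, om_val, map_mul, map_mul, sh_ph, h1, h1, sh_ph, ← cm_sh, sh_ph_inv]

lemma sh_ww (g : Y →ₐ[k] Y') : sh (sh (sh (sh g))) (q.ww Y).val = (q.ww Y').val := by
  rw [ww_val, ww_val, map_mul, sh_ph_inv, ← cm_sh, sh_ph]

lemma insert_outer (z : Ten k H (Ten k H (Ten k H (Ten k H k)))) :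
    sh (sh (sh (un (k := k) (H := H)))) (q.cm (sh (sh (sh q.cm)) z)) =
      q.cm (sh (sh (sh (sh q.cm))) (sh (sh un) z)) := by
  induction z using ind_four with
  | add x y hx hy => simp only [map_add, hx, hy]
  | pt x y t u => simp [cm_pt, pt_sum, un_apply]

lemma insert_inner (z : Ten k H (Ten k H (Ten k H (Ten k H k)))) :
    sh (sh (sh (un (k := k) (H := H)))) (sh q.cm (sh (sh q.cm) z)) =
      sh q.cm (sh (sh (sh q.cm)) (sh (sh un) z)) := by
  induction z using ind_four with
  | add x y hx hy => simp only [map_add, hx, hy]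
  | pt x y t u => simp [cm_pt, pt_sum, un_apply]

lemma insert_tail (z : Ten k H (Ten k H (Ten k H (Ten k H k)))) :
    sh (sh (un (k := k) (H := H))) (sh (sh (sh (sh (un (k := k) (H := H))))) z) =
      sh (sh (sh (sh (sh un)))) (sh (sh un) z) := by
  induction z using ind_four with
  | add x y hx hy => simp only [map_add, hx, hy]
  | pt x y t u => simp [un_apply]

end Insertion

section Coassociativity

variable {k H : Type} [Field k] [Ring H] [Algebra k H] (q : QuasiHopf k H)
variable {M V : Type} [AddCommGroup M] [Module k M]
  [AddCommGroup V] [Module k V] (r : H →ₐ[k] Module.End k V)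

lemma assoc_act4 (z : Ten k H (Ten k H (Ten k H (Ten k H k)))) (t : H ⊗[k] H) (v : V) :
    TensorProduct.assoc k H H V (q.act4 z t ⊗ₜ v) =
      q.act5 r (sh (sh un) z) (TensorProduct.assoc k H H V (t ⊗ₜ v)) := by
  induction z using ind_four with
  | add x y hx hy => simp only [map_add, LinearMap.add_apply, TensorProduct.add_tmul, hx, hy]
  | pt x y z u =>
    induction t with
    | zero => simp
    | add s s' hs hs' => simp only [map_add, TensorProduct.add_tmul, hs, hs']
    | tmul a b => simp [act5_pt, un_apply, mul_assoc]

lemma th_beta (v : V) : q.th (q.beta ⊗ₜ[k] v) =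
    q.act5 r (sh (sh un) (q.ww k).val) (q.beta ⊗ₜ (q.beta ⊗ₜ v)) := by
  rw [th_tmul, comul_beta_mul_twistInv, bEl_eq, assoc_act4 q r]; rfl

lemma assoc_act4_outer (z : Ten k H (Ten k H (Ten k H (Ten k H k)))) (t : H ⊗[k] H)
    (m : H ⊗[k] V) :
    TensorProduct.assoc k H H (H ⊗[k] V) (q.act4 z t ⊗ₜ m) =
      q.act7 r (sh (sh (un.comp (un.comp un))) z)
        (TensorProduct.assoc k H H (H ⊗[k] V) (t ⊗ₜ m)) := by
  induction z using ind_four with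
  | add x y hx hy => simp only [map_add, LinearMap.add_apply, TensorProduct.add_tmul, hx, hy]
  | pt x y z u =>
    induction t with
    | zero => simp
    | add s s' hs hs' => simp only [map_add, TensorProduct.add_tmul, hs, hs']
    | tmul a b => simp [act7_pt, un_apply, mul_assoc]

lemma th_beta_outer (m : H ⊗[k] V) : q.th (q.beta ⊗ₜ[k] m) =
    q.act7 r (sh (sh (un.comp (un.comp un))) (q.ww k).val) (q.beta ⊗ₜ (q.beta ⊗ₜ m)) := by
  rw [th_tmul, comul_beta_mul_twistInv, bEl_eq, assoc_act4_outer q r]; rfl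

lemma act7_absorb (z : Ten k H (Ten k H (Ten k H (Ten k H (Ten k H k))))) (a b : H) (v : V) :
    q.act7 r (sh (sh (sh un)) (sh (sh q.cm) z)) (a ⊗ₜ (b ⊗ₜ (q.beta ⊗ₜ v))) =
      q.act7 r (sh (sh (un.comp (un.comp un))) (sh (sh q.cu) z))
        (a ⊗ₜ (b ⊗ₜ (q.beta ⊗ₜ v))) := by
  induction z using ind_five with
  | add x y hx hy => simp only [map_add, LinearMap.add_apply, hx, hy]
  | pt x y t u w =>
    simp [act7_pt, un_apply, cm_pt, pt_sum, pt_smul, LinearMap.sum_apply,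
      ← TensorProduct.tmul_sum, ← TensorProduct.sum_tmul, ← mul_assoc, q.antipode_beta,
      ← TensorProduct.smul_tmul']

/-- The associativity constraint relating the two iterates of `th`. -/
def assocUnit : (Ten k H (Ten k H (Ten k H (Ten k H (Ten k H (Ten k H (Ten k H k)))))))ˣ :=
  (q.ph (Ten k H (Ten k H (Ten k H (Ten k H k)))))⁻¹ *
    uu k H (uu k H (uu k H (uu k H (q.ph k))))

lemma tmul_th_beta (v : V) : q.beta ⊗ₜ[k] q.th (q.beta ⊗ₜ[k] v) =
    q.act7 r (sh (sh (sh un)) (un (q.ww (Ten k H k)).val))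
      (q.beta ⊗ₜ (q.beta ⊗ₜ (q.beta ⊗ₜ v))) := by
  have h := congr_arg (fun t => t (q.beta ⊗ₜ[k] (q.beta ⊗ₜ[k] (q.beta ⊗ₜ[k] v))))
    (q.inn_act5 r (sh (sh un) (q.ww k).val))
  rw [inn_tmul, ← th_beta, ← insert_tail, sh_ww] at h
  exact h

lemma lTensor_th_th_beta (v : V) : q.th.lTensor H (q.th (q.beta ⊗ₜ[k] v)) =
    q.act7 r (sh q.cm (sh (sh (sh q.cm)) (sh (sh un) (q.ww k).val)))
      (q.act7 r (sh (sh (sh un)) (uu k H (q.ww (Ten k H k))).val)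
        (q.beta ⊗ₜ (q.beta ⊗ₜ (q.beta ⊗ₜ v)))) := by
  rw [th_beta q r v, lTensor_th_act5, LinearMap.lTensor_tmul, tmul_th_beta q r]
  rfl

lemma act7_assocUnit : q.act7 r q.assocUnit.val =
    q.act7 r (sh (sh (sh un)) (q.ph (Ten k H (Ten k H (Ten k H k))))⁻¹.val) *
      q.act7 r (sh (sh (sh un)) (uu k H (uu k H (uu k H (q.ph k)))).val) := by
  rw [← map_mul, sh_ph_inv]
  rfl

lemma th_th_beta (v : V) : q.act7 r q.assocUnit.val (q.th.lTensor H (q.th (q.beta ⊗ₜ[k] v))) =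
    q.th (q.th (q.beta ⊗ₜ v)) := by
  have h := congr_arg (fun u => q.act7 r (sh (sh (sh un)) u.val)
    (q.beta ⊗ₜ (q.beta ⊗ₜ (q.beta ⊗ₜ v)))) (q.ww_coherence (Y := k))
  have hc := q.counit_mid_ww (Y := k)
  generalize q.uc (q.uc (q.ph k)) * (q.ph (Ten k H (Ten k H k)))⁻¹ *
    (q.uc1 (q.ph (Ten k H k)))⁻¹ = c at h hc
  simp only [Units.val_mul, map_mul, um_val, insert_outer, insert_inner, Module.End.mul_apply,
    act7_absorb] at h
  rw [hc, ← th_beta_outer, ← th_act5, ← th_beta] at h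
  rw [← h, lTensor_th_th_beta, act7_assocUnit, Module.End.mul_apply]

lemma assocUnit_comm (z : Ten k H (Ten k H (Ten k H k))) :
    q.assocUnit.val * sh q.cm (sh (sh (sh q.cm)) (sh (sh (sh q.cm)) (q.cm z))) =
      q.cm (sh (sh (sh (sh q.cm))) (sh (sh (sh q.cm)) (q.cm z))) * q.assocUnit.val := by
  have h1 : sh (sh (sh q.cm)) (sh (sh q.cm) z) * (uu k H (uu k H (q.ph k))).val =
      (uu k H (uu k H (q.ph k))).val * sh (sh q.cm) (sh (sh q.cm) z) := by
    rw [← sh_sh_comp, ← sh_sh_comp]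
    exact sh_mul_un (sh_mul_un q.cm_coassoc) z
  have h2 := congr_arg (fun t => sh q.cm (q.cm t)) h1
  have h3 : sh q.cm (q.cm (uu k H (uu k H (q.ph k))).val) =
      (uu k H (uu k H (uu k H (uu k H (q.ph k))))).val :=
    congr_arg Units.val (show q.uc1 (q.uc (uu k H (uu k H (q.ph k)))) = _ by
      rw [uc_uu, uc1_uu, uc_uu])
  simp only [map_mul, h3] at h2
  rw [← cm_sh, ← cm_sh, ← cm_sh, assocUnit, Units.val_mul, mul_assoc, ← h2, ← mul_assoc,
    ph_inv_comm, mul_assoc]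

lemma tmul_eq_act3_beta (a : H) (v : V) : a ⊗ₜ[k] v = ∑ b ∈ Finset.range q.nq,
    q.act3 r (pt (a * q.S (q.Q1 b) * q.alpha * q.Q2 b) (pt 1 (pt (q.Q3 b) 1)))
      (q.beta ⊗ₜ v) := by
  have h := congr_arg (fun t => (a * t) ⊗ₜ[k] v) q.nondeg_2
  simp only [Finset.mul_sum, TensorProduct.sum_tmul, mul_one] at h
  simp only [act3_pt, ← h]
  simp [mul_assoc]

lemma th_th_assocUnit (m : H ⊗[k] V) :
    q.act7 r q.assocUnit.val (q.th.lTensor H (q.th m)) = q.th (q.th m) := by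
  induction m with
  | zero => simp
  | add s t hs ht => simp only [map_add, hs, ht]
  | tmul a v =>
    simp only [q.tmul_eq_act3_beta r a v, map_sum]
    refine Finset.sum_congr rfl fun b _ => ?_
    rw [th_act3, lTensor_th_act5, th_act5, ← Module.End.mul_apply, ← map_mul, assocUnit_comm,
      map_mul, Module.End.mul_apply, th_th_beta]

lemma lTensor_th_th (m : H ⊗[k] V) : q.th.lTensor H (q.th m) =
    q.act7 r (q.ph (Ten k H (Ten k H (Ten k H (Ten k H k)))) *
      (uu k H (uu k H (uu k H (uu k H (q.ph k)))))⁻¹).val (q.th (q.th m)) := by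
  rw [← q.th_th_assocUnit r, ← Module.End.mul_apply, ← map_mul, ← Units.val_mul, assocUnit]
  have h := q.ph_uu_comm (uu k H (q.ph k))
  generalize q.ph (Ten k H (Ten k H (Ten k H (Ten k H k)))) = a at h ⊢
  generalize uu k H (uu k H (uu k H (uu k H (q.ph k)))) = b at h ⊢
  rw [show a * b⁻¹ * (a⁻¹ * b) = 1 by
    rw [mul_assoc, ← mul_assoc b⁻¹, ← mul_inv_rev, h, mul_inv_rev]; group]
  rw [Units.val_one, map_one, Module.End.one_apply]

lemma actOn_eq (h : H) : q.actOn (fun g => r g) h = q.ra r h := by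
  ext a v
  simp [actOn, ra, hl_apply, cm_pt, act3_pt, LinearMap.sum_apply]

lemma coactOn_eq (m : H ⊗[k] V) :
    q.coactOn (fun g => r g) m = q.act5 r (q.om k).val (q.th m) := by
  induction m with
  | zero => simp
  | add s t hs ht => simp only [map_add, hs, ht]
  | tmul x v =>
    have h : (q.om k).val = sh q.cm ((q.ph (Ten k H k)).val * q.cm (q.ph k)⁻¹.val) *
      (q.ph (Ten k H (Ten k H k))).val := by rw [om_val, map_mul]
    rw [h]
    simp only [ph_val, ph_inv_val, map_sum, cm_pt, Finset.sum_mul, Finset.mul_sum, pt_mul, pt_sum,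
      sh_pt, LinearMap.sum_apply, one_mul, mul_one, act5_pt, one_smul, coactOn, LinearMap.comp_apply,
      TensorProduct.map_tmul, LinearMap.mulLeft_apply, LinearMap.mulRight_apply,
      AlgHom.toLinearMap_apply, LinearEquiv.coe_coe]
    rw [Finset.sum_comm]
    conv_rhs => rw [Finset.sum_comm]
    refine Finset.sum_congr rfl fun b _ => ?_
    rw [Finset.sum_comm]
    conv_rhs => rw [Finset.sum_comm]
    refine Finset.sum_congr rfl fun m _ => ?_
    rw [Finset.sum_comm]
    refine Finset.sum_congr rfl fun c _ => Finset.sum_congr rfl fun a _ =>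
      Finset.sum_congr rfl fun e _ => ?_
    rw [assoc_mul_left, assoc_inn, ← mul_assoc, assoc_mul_right, th_tmul]

lemma hd_act5 (z : Ten k H (Ten k H (Ten k H (Ten k H (Ten k H k))))) (m : H ⊗[k] (H ⊗[k] V)) :
    q.hd (q.act5 r z m) = q.act3 r (sh (sh (sh q.cu)) (q.cu z)) (q.hd m) := by
  induction z using ind_five with
  | add x y hx hy => simp only [map_add, LinearMap.add_apply, hx, hy]
  | pt x y t u w =>
    induction m with
    | zero => simp
    | add s s' hs hs' => simp only [map_add, hs, hs']
    | tmul a b =>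
      simp [act5_pt, act3_pt, counit_S, smul_smul, mul_comm, mul_left_comm]

lemma hd_th (m : H ⊗[k] M) : q.hd (q.th m) = m := by
  have h (t : H ⊗[k] H) (m : M) : q.hd (TensorProduct.assoc k H H M (t ⊗ₜ m)) = q.hd t ⊗ₜ m := by
    induction t with
    | zero => simp
    | add s s' hs hs' => simp only [map_add, TensorProduct.add_tmul, hs, hs']
    | tmul a b => simp [TensorProduct.smul_tmul']
  induction m with
  | zero => simp
  | add s t hs ht => simp only [map_add, hs, ht]
  | tmul a v => rw [th_tmul, h, hd_mul, hd_comul, hd_twistInv, mul_one]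

end Coassociativity

section YetterDrinfeld

variable {k H : Type} [Field k] [Ring H] [Algebra k H] (q : QuasiHopf k H)
variable {V : Type} [AddCommGroup V] [Module k V] (r : H →ₐ[k] Module.End k V)

lemma counit_coactOn (m : H ⊗[k] V) : q.hd (q.coactOn (fun g => r g) m) = m := by
  rw [coactOn_eq, hd_act5, om_counit, map_one, hd_th, Module.End.one_apply]

lemma lTensor_coactOn (m : H ⊗[k] (H ⊗[k] V)) :
    (q.coactOn (fun g => r g)).lTensor H m =
      q.act7 r (uu k H (q.om (Ten k H k))).val (q.th.lTensor H m) := by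
  have h : q.coactOn (fun g => r g) = q.act5 r (q.om k).val ∘ₗ q.th :=
    LinearMap.ext fun m => q.coactOn_eq r m
  have h' := q.inn_act5 r (q.om k).val
  rw [sh_om] at h'
  rw [h, LinearMap.lTensor_comp, LinearMap.comp_apply]
  exact congr_arg (fun t => t (q.th.lTensor H m)) h'

lemma coactOn_coassoc (m : H ⊗[k] V) :
    (q.coactOn (fun g => r g)).lTensor H (q.coactOn (fun g => r g) m) =
      q.coactOn (fun g => q.ra r g) (q.coactOn (fun g => r g) m) := by
  rw [lTensor_coactOn, coactOn_eq, coactOn_eq, lTensor_th_act5, lTensor_th_th q r, act5_ra,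
    th_act5]
  have h := congr_arg (fun u => q.act7 r u.val (q.th (q.th m))) (q.om_coassoc (Y := k))
  generalize q.ph (Ten k H (Ten k H (Ten k H (Ten k H k)))) *
    (uu k H (uu k H (uu k H (uu k H (q.ph k)))))⁻¹ = c at h ⊢
  simp only [Units.val_mul, map_mul, um_val, Module.End.mul_apply] at h
  exact h

lemma coactOn_ra (h : H) (m : H ⊗[k] V) :
    q.coactOn (fun g => r g) (q.ra r h m) =
      q.ra (q.ra r) h (q.coactOn (fun g => r g) m) := by
  have h1 : q.ra (q.ra r) h = q.act5 r (sh q.cm (sh q.cm (q.cm (q.cm (hl h))))) :=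
    q.act3_ra r _
  rw [coactOn_eq, coactOn_eq, h1, ← Module.End.mul_apply, ← map_mul, ← om_nat, map_mul,
    Module.End.mul_apply, ← th_act3]
  rfl

end YetterDrinfeld

end QuasiHopf

/-- For a left `H`-module `V`, the space `H ⊗ V` with the action
`h · (a ⊗ v) = h₍₁,₁₎ a S(h₍₂₎) ⊗ h₍₁,₂₎ v` and the coaction
`δ(a ⊗ v) = ω1 a₍₁₎ ω5 ⊗ (ω2 a₍₂₎ ω4 ⊗ ω3 v)` is a Yetter–Drinfeld module of the
second kind: (i) `·` is an `H`-module structure; (ii) `ε(m₍₋₁₎) m₍₀₎ = m`;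
(iii) the quasi-coassociativity of the coaction; (iv) the compatibility
`δ(h · m) = h₍₁,₁₎ m₍₋₁₎ S(h₍₂₎) ⊗ h₍₁,₂₎ · m₍₀₎`. -/
theorem statement13 (k H : Type) [Field k] [Ring H] [Algebra k H] (q : QuasiHopf k H)
    (V : Type) [AddCommGroup V] [Module k V] (ρV : H →ₐ[k] Module.End k V) :
    -- (i) module structure
    (q.actOn (fun h => ρV h) 1 = LinearMap.id) ∧
    (∀ g h : H, q.actOn (fun h' => ρV h') (g * h) =
        (q.actOn (fun h' => ρV h') g) ∘ₗ (q.actOn (fun h' => ρV h') h)) ∧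
    (∀ g h : H, q.actOn (fun h' => ρV h') (g + h) =
        q.actOn (fun h' => ρV h') g + q.actOn (fun h' => ρV h') h) ∧
    (∀ (c : k) (h : H), q.actOn (fun h' => ρV h') (c • h) =
        c • q.actOn (fun h' => ρV h') h) ∧
    -- (ii) counit property of the coaction
    (∀ m : H ⊗[k] V,
      (TensorProduct.lid k (H ⊗[k] V))
        ((TensorProduct.map q.counit.toLinearMap LinearMap.id)
          (q.coactOn (fun h => ρV h) m)) = m) ∧
    -- (iii) quasi-coassociativity
    (∀ m : H ⊗[k] V,
      (TensorProduct.map LinearMap.id (q.coactOn (fun h => ρV h)))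
          (q.coactOn (fun h => ρV h) m) =
        (q.coactOn (fun h => q.actOn (fun h' => ρV h') h))
          (q.coactOn (fun h => ρV h) m)) ∧
    -- (iv) Yetter–Drinfeld compatibility
    (∀ (h : H) (m : H ⊗[k] V),
      q.coactOn (fun h' => ρV h') (q.actOn (fun h' => ρV h') h m) =
        (q.actOn (fun g => q.actOn (fun h' => ρV h') g) h)
          (q.coactOn (fun h' => ρV h') m)) := by
  simp only [q.actOn_eq ρV, q.actOn_eq (q.ra ρV)]
  exact ⟨map_one _, map_mul _, map_add _, map_smul _, q.counit_coactOn ρV, q.coactOn_coassoc ρV,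
    q.coactOn_ra ρV⟩
end
end

section
/- Let H be a quasi-Hopf algebra over a field k with bijective antipode S. On H define the adjoint action h ▷ a = h_(1) a S(h_(2)) and the product a ⋆ b = φ1 a S(φ̄1 φ2) α φ̄2 φ3_(1) b S(φ̄3 φ3_(2)). Then: (i) β ⋆ a = a = a ⋆ β for all a ∈ H; (ii) (a ⋆ b) ⋆ c = (φ1 ▷ a) ⋆ ((φ2 ▷ b) ⋆ (φ3 ▷ c)) for all a, b, c ∈ H; (iii) h ▷ (a ⋆ b) = (h_(1) ▷ a) ⋆ (h_(2) ▷ b) and h ▷ β = ε(h)·β for all h, a, b ∈ H. Hence (H, ⋆, β) is an algebra in the monoidal category of left H-modules (the adjoint algebra 𝐀). -/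
open scoped TensorProduct

noncomputable section

namespace QuasiHopf

variable {k H : Type} [Field k] [Ring H] [Algebra k H] (q : QuasiHopf k H)

/-- The adjoint action `h ▷ a = h₍₁₎ a S(h₍₂₎)`. -/
def ad (h a : H) : H := ∑ i ∈ Finset.range (q.n h), q.d1 h i * a * q.S (q.d2 h i)

/-- The multiplication `a ⋆ b = φ1 a S(φ̄1 φ2) α φ̄2 φ3₍₁₎ b S(φ̄3 φ3₍₂₎)` of the
adjoint algebra. -/
def star (a b : H) : H :=
  ∑ c ∈ Finset.range q.np, ∑ e ∈ Finset.range q.nq, ∑ m ∈ Finset.range (q.n (q.P3 c)),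
    q.P1 c * a * q.S (q.Q1 e * q.P2 c) * q.alpha * q.Q2 e * q.d1 (q.P3 c) m * b *
      q.S (q.Q3 e * q.d2 (q.P3 c) m)

end QuasiHopf

/-- Two algebra maps with a common target whose images commute elementwise. -/
class CommutingMaps {k A A' B : Type} [Field k] [Ring A] [Algebra k A] [Ring A'] [Algebra k A']
    [Ring B] [Algebra k B] (f : A →ₐ[k] B) (g : A' →ₐ[k] B) : Prop where
  commute : ∀ x y, Commute (f x) (g y)

namespace CommutingMaps

variable {k A₁ A₂ A₃ B : Type} [Field k] [Ring A₁] [Algebra k A₁] [Ring A₂] [Algebra k A₂]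
  [Ring A₃] [Algebra k A₃] [Ring B] [Algebra k B]

/-- The algebra map `x ⊗ y ↦ f x * g y`. -/
def pair (f : A₁ →ₐ[k] B) (g : A₂ →ₐ[k] B) [CommutingMaps f g] : A₁ ⊗[k] A₂ →ₐ[k] B :=
  Algebra.TensorProduct.lift f g commute

@[simp]
theorem pair_tmul (f : A₁ →ₐ[k] B) (g : A₂ →ₐ[k] B) [CommutingMaps f g] (x : A₁) (y : A₂) :
    pair f g (x ⊗ₜ y) = f x * g y :=
  rfl

instance pair_left (f : A₁ →ₐ[k] B) (g : A₂ →ₐ[k] B) (h : A₃ →ₐ[k] B) [CommutingMaps f g]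
    [CommutingMaps f h] [CommutingMaps g h] : CommutingMaps (pair f g) h where
  commute x y := by
    induction x using TensorProduct.induction_on with
    | zero => simp
    | tmul a b => exact (commute a y).mul_left (commute b y)
    | add a b ha hb => rw [map_add]; exact ha.add_left hb

instance pair_right (f : A₁ →ₐ[k] B) (g : A₂ →ₐ[k] B) (h : A₃ →ₐ[k] B) [CommutingMaps f g]
    [CommutingMaps f h] [CommutingMaps g h] : CommutingMaps f (pair g h) where
  commute x y := by
    induction y using TensorProduct.induction_on with
    | zero => simp
    | tmul a b => exact (commute x a).mul_right (commute x b)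
    | add a b ha hb => rw [map_add]; exact ha.add_right hb

end CommutingMaps

namespace QuasiHopf

open CommutingMaps

section Convolution

variable {k H B : Type} [Field k] [Ring H] [Algebra k H] [Ring B] [Algebra k B]
  (q : QuasiHopf k H)

/-- The convolution `x ↦ f x₍₁₎ * g x₍₂₎` of two commuting algebra maps. -/
def conv (f g : H →ₐ[k] B) [CommutingMaps f g] : H →ₐ[k] B :=
  (pair f g).comp q.comul

/-- The counit, viewed as an algebra map into `B`. -/
def counitMap (B : Type) [Ring B] [Algebra k B] : H →ₐ[k] B :=
  (Algebra.ofId k B).comp q.counit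

/-- The image of `φ` under three commuting algebra maps. -/
def phi (f g h : H →ₐ[k] B) [CommutingMaps f g] [CommutingMaps f h] [CommutingMaps g h] : B :=
  pair f (pair g h) q.Phi

/-- The image of `φ⁻¹` under three commuting algebra maps. -/
def phiBar (f g h : H →ₐ[k] B) [CommutingMaps f g] [CommutingMaps f h] [CommutingMaps g h] :
    B :=
  pair f (pair g h) q.PhiInv

theorem conv_apply (f g : H →ₐ[k] B) [CommutingMaps f g] (x : H) :
    q.conv f g x = ∑ i ∈ Finset.range (q.n x), f (q.d1 x i) * g (q.d2 x i) := by
  simp [conv, q.comul_eq x]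

theorem phi_eq_sum (f g h : H →ₐ[k] B) [CommutingMaps f g] [CommutingMaps f h]
    [CommutingMaps g h] :
    q.phi f g h = ∑ a ∈ Finset.range q.np, f (q.P1 a) * (g (q.P2 a) * h (q.P3 a)) := by
  simp [phi, Phi]

theorem phiBar_eq_sum (f g h : H →ₐ[k] B) [CommutingMaps f g] [CommutingMaps f h]
    [CommutingMaps g h] :
    q.phiBar f g h = ∑ b ∈ Finset.range q.nq, f (q.Q1 b) * (g (q.Q2 b) * h (q.Q3 b)) := by
  simp [phiBar, PhiInv]

instance conv_left (f g h : H →ₐ[k] B) [CommutingMaps f g] [CommutingMaps f h]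
    [CommutingMaps g h] : CommutingMaps (q.conv f g) h where
  commute x y := commute (f := pair f g) (q.comul x) y

instance conv_right (f g h : H →ₐ[k] B) [CommutingMaps f g] [CommutingMaps f h]
    [CommutingMaps g h] : CommutingMaps f (q.conv g h) where
  commute x y := commute (g := pair g h) x (q.comul y)

instance counitMap_left (f : H →ₐ[k] B) : CommutingMaps (q.counitMap B) f where
  commute _ _ := Algebra.commutes _ _

instance counitMap_right (f : H →ₐ[k] B) : CommutingMaps f (q.counitMap B) where
  commute _ _ := (Algebra.commutes _ _).symm

theorem counitMap_apply (x : H) : q.counitMap B x = algebraMap k B (q.counit x) :=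
  rfl

theorem conv_counitMap_left (f : H →ₐ[k] B) : q.conv (q.counitMap B) f = f := by
  ext x
  conv_rhs => rw [← q.counit_left x]
  simp [conv_apply, counitMap_apply, Algebra.smul_def]

theorem conv_counitMap_right (f : H →ₐ[k] B) : q.conv f (q.counitMap B) = f := by
  ext x
  conv_rhs => rw [← q.counit_right x]
  simp [conv_apply, counitMap_apply, Algebra.smul_def, Algebra.commutes (A := B)]

section Triple

variable (f g h : H →ₐ[k] B) [CommutingMaps f g] [CommutingMaps f h] [CommutingMaps g h]

theorem phi_mul_phiBar : q.phi f g h * q.phiBar f g h = 1 := by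
  rw [phi, phiBar, ← map_mul, Phi, PhiInv, q.phi_phiInv, map_one]

theorem phiBar_mul_phi : q.phiBar f g h * q.phi f g h = 1 := by
  rw [phi, phiBar, ← map_mul, Phi, PhiInv, q.phiInv_phi, map_one]

/-- Quasi-coassociativity, pushed forward along commuting algebra maps. -/
theorem phi_mul_conv (x : H) :
    q.phi f g h * q.conv (q.conv f g) h x = q.conv f (q.conv g h) x * q.phi f g h := by
  have hx := congrArg (pair f (pair g h)) (q.qcoassoc x)
  rw [map_mul, map_mul] at hx
  change _ = q.phi f g h * _ * q.phiBar f g h at hx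
  have h₁ : q.conv f (q.conv g h) x = pair f (pair g h)
      (∑ i ∈ Finset.range (q.n x), q.d1 x i ⊗ₜ[k] q.comul (q.d2 x i)) := by
    rw [conv_apply]
    simp [conv]
  have h₂ : q.conv (q.conv f g) h x = pair f (pair g h)
      (∑ i ∈ Finset.range (q.n x), ∑ j ∈ Finset.range (q.n (q.d1 x i)),
          q.d1 (q.d1 x i) j ⊗ₜ[k] (q.d2 (q.d1 x i) j ⊗ₜ[k] q.d2 x i)) := by
    simp [conv_apply, Finset.sum_mul, mul_assoc]
  rw [h₁, hx, ← h₂, mul_assoc _ (q.phiBar f g h), phiBar_mul_phi, mul_one]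

theorem phiBar_mul_conv (x : H) :
    q.phiBar f g h * q.conv f (q.conv g h) x = q.conv (q.conv f g) h x * q.phiBar f g h := by
  calc _ = q.phiBar f g h * (q.conv f (q.conv g h) x * q.phi f g h) * q.phiBar f g h := by
        rw [mul_assoc, mul_assoc, phi_mul_phiBar, mul_one]
    _ = _ := by rw [← phi_mul_conv, ← mul_assoc, phiBar_mul_phi, one_mul]

end Triple

/-- The pentagon identity, pushed forward along commuting algebra maps. -/
theorem phi_pentagon (f g h l : H →ₐ[k] B) [CommutingMaps f g] [CommutingMaps f h]
    [CommutingMaps f l] [CommutingMaps g h] [CommutingMaps g l] [CommutingMaps h l] :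
    q.phi f g (q.conv h l) * q.phi (q.conv f g) h l =
      q.phi g h l * q.phi f (q.conv g h) l * q.phi f g h := by
  have hp := congrArg (pair f (pair g (pair h l))) q.pentagon
  rw [map_mul, map_mul, map_mul] at hp
  convert hp using 2
  · simp [phi_eq_sum, conv]
  · simp [phi_eq_sum, conv_apply, Finset.sum_mul, mul_assoc]
  · congr 1
    · simp [phi_eq_sum]
    · simp [phi_eq_sum, conv_apply, Finset.sum_mul, Finset.mul_sum, mul_assoc]
  · simp [phi_eq_sum]

theorem phiBar_pentagon (f g h l : H →ₐ[k] B) [CommutingMaps f g] [CommutingMaps f h]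
    [CommutingMaps f l] [CommutingMaps g h] [CommutingMaps g l] [CommutingMaps h l] :
    q.phiBar (q.conv f g) h l * q.phiBar f g (q.conv h l) =
      q.phiBar f g h * q.phiBar f (q.conv g h) l * q.phiBar g h l := by
  refine left_inv_eq_right_inv (a := q.phi f g (q.conv h l) * q.phi (q.conv f g) h l) ?_ ?_
  · rw [mul_assoc, ← mul_assoc (q.phiBar f g _), phiBar_mul_phi, one_mul, phiBar_mul_phi]
  · rw [phi_pentagon]
    simp only [mul_assoc]
    rw [← mul_assoc (q.phi f g h), phi_mul_phiBar, one_mul, ← mul_assoc (q.phi f _ l),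
      phi_mul_phiBar, one_mul, phi_mul_phiBar]

theorem phi_counit_middle (f g : H →ₐ[k] B) [CommutingMaps f g] :
    q.phi f (q.counitMap B) g = 1 := by
  have hc := congrArg (pair f g) q.counit_mid_phi
  simp only [map_sum, map_smul, pair_tmul, map_one, mul_one] at hc
  rw [phi_eq_sum, ← hc]
  refine Finset.sum_congr rfl fun a _ => ?_
  rw [counitMap_apply, Algebra.smul_def, Algebra.left_comm]

theorem phi_counit_right (f g : H →ₐ[k] B) [CommutingMaps f g] :
    q.phi f g (q.counitMap B) = 1 := by
  have hp := q.phi_pentagon f g (q.counitMap B) (q.counitMap B)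
  simp only [conv_counitMap_right, phi_counit_middle, mul_one,
    one_mul] at hp
  have := congrArg (q.phiBar f g (q.counitMap B) * ·) hp
  simpa [← mul_assoc, phiBar_mul_phi] using this.symm

theorem phi_counit_left (f g : H →ₐ[k] B) [CommutingMaps f g] :
    q.phi (q.counitMap B) f g = 1 := by
  have hp := q.phi_pentagon (q.counitMap B) (q.counitMap B) f g
  simp only [conv_counitMap_left, conv_counitMap_right, phi_counit_middle, mul_one,
    one_mul] at hp
  have := congrArg (· * q.phiBar (q.counitMap B) f g) hp
  simpa [mul_assoc, phi_mul_phiBar] using this.symm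

theorem phiBar_counit_left (f g : H →ₐ[k] B) [CommutingMaps f g] :
    q.phiBar (q.counitMap B) f g = 1 := by
  simpa [phi_counit_left] using q.phi_mul_phiBar (q.counitMap B) f g

/-- The reassociation `(12)(34) → 1((23)4)` through `1(2(34))`. -/
def reassoc (f g h l : H →ₐ[k] B) [CommutingMaps f g] [CommutingMaps f h]
    [CommutingMaps f l] [CommutingMaps g h] [CommutingMaps g l] [CommutingMaps h l] : B :=
  q.phiBar g h l * q.phi f g (q.conv h l)

/-- The reassociation `(12)(34) → (1(23))4` through `((12)3)4`. -/
def reassoc' (f g h l : H →ₐ[k] B) [CommutingMaps f g] [CommutingMaps f h]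
    [CommutingMaps f l] [CommutingMaps g h] [CommutingMaps g l] [CommutingMaps h l] : B :=
  q.phi f g h * q.phiBar (q.conv f g) h l

theorem reassoc_eq (f g h l : H →ₐ[k] B) [CommutingMaps f g] [CommutingMaps f h]
    [CommutingMaps f l] [CommutingMaps g h] [CommutingMaps g l] [CommutingMaps h l] :
    q.reassoc f g h l = q.phi f (q.conv g h) l * q.reassoc' f g h l := by
  calc q.reassoc f g h l
      = q.phiBar g h l * (q.phi f g (q.conv h l) * q.phi (q.conv f g) h l) *
          q.phiBar (q.conv f g) h l := by
        simp only [reassoc, mul_assoc, phi_mul_phiBar, mul_one]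
    _ = q.phiBar g h l * q.phi g h l * (q.phi f (q.conv g h) l * q.reassoc' f g h l) := by
        simp only [phi_pentagon, reassoc', mul_assoc]
    _ = _ := by rw [phiBar_mul_phi, one_mul]

end Convolution

section Intertwining

variable {k H V W : Type} [Field k] [Ring H] [Algebra k H] [AddCommGroup V] [Module k V]
  [AddCommGroup W] [Module k W] (q : QuasiHopf k H)

/-- The linear map `T` intertwines the actions `f` and `f'` of `H`. -/
def Intertwines (T : V →ₗ[k] W) (f : H →ₐ[k] Module.End k V) (f' : H →ₐ[k] Module.End k W) :
    Prop :=
  ∀ x v, T (f x v) = f' x (T v)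

variable {T : V →ₗ[k] W} {f g h l : H →ₐ[k] Module.End k V} {f' g' h' l' : H →ₐ[k] Module.End k W}
  [CommutingMaps f g] [CommutingMaps f' g']

theorem Intertwines.conv (hf : Intertwines T f f') (hg : Intertwines T g g') :
    Intertwines T (q.conv f g) (q.conv f' g') := fun x v => by
  simp [conv_apply, LinearMap.sum_apply, hf _ _, hg _ _]

theorem Intertwines.conv_counit_left {g' : H →ₐ[k] Module.End k W}
    (hf : Intertwines T f (q.counitMap _)) (hg : Intertwines T g g') :
    Intertwines T (q.conv f g) g' := by
  simpa only [conv_counitMap_left] using hf.conv q hg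

theorem Intertwines.conv_counit_right {f' : H →ₐ[k] Module.End k W}
    (hf : Intertwines T f f') (hg : Intertwines T g (q.counitMap _)) :
    Intertwines T (q.conv f g) f' := by
  simpa only [conv_counitMap_right] using hf.conv q hg

variable [CommutingMaps f h] [CommutingMaps g h] [CommutingMaps f' h'] [CommutingMaps g' h']

theorem Intertwines.phi (hf : Intertwines T f f') (hg : Intertwines T g g')
    (hh : Intertwines T h h') (v : V) : T (q.phi f g h v) = q.phi f' g' h' (T v) := by
  simp [phi_eq_sum, LinearMap.sum_apply, hf _ _, hg _ _, hh _ _]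

theorem Intertwines.phiBar (hf : Intertwines T f f') (hg : Intertwines T g g')
    (hh : Intertwines T h h') (v : V) : T (q.phiBar f g h v) = q.phiBar f' g' h' (T v) := by
  simp [phiBar_eq_sum, LinearMap.sum_apply, hf _ _, hg _ _, hh _ _]

variable [CommutingMaps f l] [CommutingMaps g l] [CommutingMaps h l]
  [CommutingMaps f' l'] [CommutingMaps g' l'] [CommutingMaps h' l']

theorem Intertwines.reassoc (hf : Intertwines T f f') (hg : Intertwines T g g')
    (hh : Intertwines T h h') (hl : Intertwines T l l') (v : V) :
    T (q.reassoc f g h l v) = q.reassoc f' g' h' l' (T v) := by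
  simp only [QuasiHopf.reassoc, Module.End.mul_apply]
  rw [hg.phiBar q hh hl, hf.phi q hg (hh.conv q hl)]

end Intertwining

section TensorExt

variable {k H V V' V'' W : Type} [Field k] [Ring H] [Algebra k H] [AddCommGroup V] [Module k V]
  [AddCommGroup V'] [Module k V'] [AddCommGroup V''] [Module k V''] [AddCommGroup W] [Module k W]
  {f' : H →ₐ[k] Module.End k W}

theorem Intertwines.of_tmul {T : V ⊗[k] V' →ₗ[k] W} {f : H →ₐ[k] Module.End k (V ⊗[k] V')}
    (hT : ∀ x v w, T (f x (v ⊗ₜ w)) = f' x (T (v ⊗ₜ w))) : Intertwines T f f' := fun x =>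
  LinearMap.congr_fun (f := T ∘ₗ f x) (g := f' x ∘ₗ T) (TensorProduct.ext' (hT x))

theorem Intertwines.of_tmul_tmul {T : V ⊗[k] (V' ⊗[k] V'') →ₗ[k] W}
    {f : H →ₐ[k] Module.End k (V ⊗[k] (V' ⊗[k] V''))}
    (hT : ∀ x u v w, T (f x (u ⊗ₜ (v ⊗ₜ w))) = f' x (T (u ⊗ₜ (v ⊗ₜ w)))) :
    Intertwines T f f' := fun x =>
  LinearMap.congr_fun (f := T ∘ₗ f x) (g := f' x ∘ₗ T)
    (TensorProduct.ext (LinearMap.ext fun u => TensorProduct.ext' (hT x u)))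

end TensorExt

section Coherence

variable {k H V : Type} [Field k] [Ring H] [Algebra k H] [AddCommGroup V] [Module k V]
  (q : QuasiHopf k H)

variable (f g h l : H →ₐ[k] Module.End k V) [CommutingMaps f g] [CommutingMaps f h]
    [CommutingMaps f l] [CommutingMaps g h] [CommutingMaps g l] [CommutingMaps h l]

theorem intertwines_phi_left : Intertwines (q.phi g h l) f f := fun x v =>
  LinearMap.congr_fun (commute (g := pair g (pair h l)) x q.Phi).symm.eq v

theorem intertwines_phi_right : Intertwines (q.phi f g h) l l := fun x v =>
  LinearMap.congr_fun (commute (f := pair f (pair g h)) q.Phi x).eq v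

theorem intertwines_phiBar_left : Intertwines (q.phiBar g h l) f f := fun x v =>
  LinearMap.congr_fun (commute (g := pair g (pair h l)) x q.PhiInv).symm.eq v

theorem intertwines_phiBar_right : Intertwines (q.phiBar f g h) l l := fun x v =>
  LinearMap.congr_fun (commute (f := pair f (pair g h)) q.PhiInv x).eq v

theorem intertwines_phi_conv :
    Intertwines (q.phi f g h) (q.conv (q.conv f g) h) (q.conv f (q.conv g h)) := fun x v =>
  LinearMap.congr_fun (q.phi_mul_conv f g h x) v

theorem intertwines_phiBar_conv :
    Intertwines (q.phiBar f g h) (q.conv f (q.conv g h)) (q.conv (q.conv f g) h) := fun x v =>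
  LinearMap.congr_fun (q.phiBar_mul_conv f g h x) v

/-- Two reassociations of `((12)(34))(56)`, ending in `1((((23)4)5)6)` and `1((2(3(45)))6)`,
agree up to `((23)4)5 → 2(3(45))`. -/
theorem reassoc_coherence (a b c d e f : H →ₐ[k] Module.End k V)
    [CommutingMaps a b] [CommutingMaps a c] [CommutingMaps a d] [CommutingMaps a e]
    [CommutingMaps a f] [CommutingMaps b c] [CommutingMaps b d] [CommutingMaps b e]
    [CommutingMaps b f] [CommutingMaps c d] [CommutingMaps c e] [CommutingMaps c f]
    [CommutingMaps d e] [CommutingMaps d f] [CommutingMaps e f] :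
    q.phi b c (q.conv d e) * (q.phi (q.conv b c) d e *
      (q.reassoc a (q.conv (q.conv b c) d) e f * q.reassoc a b c d)) =
    q.reassoc a b (q.conv c (q.conv d e)) f *
      (q.reassoc' c d e f * q.phi (q.conv a b) (q.conv c d) (q.conv e f)) := by
  have nat₁ : q.phi a (q.conv (q.conv b c) d) (q.conv e f) * q.phiBar b c d =
      q.phiBar b c d * q.phi a (q.conv b (q.conv c d)) (q.conv e f) :=
    LinearMap.ext fun v => ((q.intertwines_phiBar_left a b c d).phi q
      (q.intertwines_phiBar_conv b c d) (q.intertwines_phiBar_right b c d _) v).symm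
  have nat₂ : q.phiBar (q.conv (q.conv b c) d) e f * q.phiBar b c d =
      q.phiBar b c d * q.phiBar (q.conv b (q.conv c d)) e f :=
    LinearMap.ext fun v => ((q.intertwines_phiBar_conv b c d).phiBar q
      (q.intertwines_phiBar_right b c d e) (q.intertwines_phiBar_right b c d f) v).symm
  have nat₃ : q.phi a b (q.conv (q.conv c (q.conv d e)) f) * q.phi c d e =
      q.phi c d e * q.phi a b (q.conv (q.conv (q.conv c d) e) f) :=
    LinearMap.ext fun v => ((q.intertwines_phi_left a c d e).phi q
      (q.intertwines_phi_left b c d e)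
      ((q.intertwines_phi_conv c d e).conv q (q.intertwines_phi_right c d e f)) v).symm
  have nat₄ : q.phi a b (q.conv (q.conv (q.conv c d) e) f) * q.phiBar (q.conv c d) e f =
      q.phiBar (q.conv c d) e f * q.phi a b (q.conv (q.conv c d) (q.conv e f)) :=
    LinearMap.ext fun v => ((q.intertwines_phiBar_left a (q.conv c d) e f).phi q
      (q.intertwines_phiBar_left b _ e f) (q.intertwines_phiBar_conv (q.conv c d) e f) v).symm
  have nat₅ : q.phiBar b (q.conv c (q.conv d e)) f * q.phi c d e =
      q.phi c d e * q.phiBar b (q.conv (q.conv c d) e) f :=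
    LinearMap.ext fun v => ((q.intertwines_phi_left b c d e).phiBar q
      (q.intertwines_phi_conv c d e) (q.intertwines_phi_right c d e f) v).symm
  have pent₁ := q.phi_pentagon b c d e
  have pent₂ : q.phi a (q.conv b (q.conv c d)) (q.conv e f) * q.phi a b (q.conv c d) =
      q.phiBar b (q.conv c d) (q.conv e f) * (q.phi a b (q.conv (q.conv c d) (q.conv e f)) *
        q.phi (q.conv a b) (q.conv c d) (q.conv e f)) := by
    rw [phi_pentagon, mul_assoc, ← mul_assoc (q.phiBar _ _ _), phiBar_mul_phi, one_mul]
  have pent₃ := q.phiBar_pentagon b (q.conv c d) e f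
  have inv₁ := q.phi_mul_phiBar b c d
  have inv₂ := q.phi_mul_phiBar b (q.conv c d) e
  simp only [reassoc, reassoc']
  calc _ = (q.phi b c (q.conv d e) * q.phi (q.conv b c) d e) *
        (q.phiBar (q.conv (q.conv b c) d) e f *
          (q.phi a (q.conv (q.conv b c) d) (q.conv e f) * q.phiBar b c d) *
            q.phi a b (q.conv c d)) := by simp only [mul_assoc]
    _ = q.phi c d e * q.phi b (q.conv c d) e * (q.phi b c d * q.phiBar b c d) *
        (q.phiBar (q.conv b (q.conv c d)) e f *
          (q.phi a (q.conv b (q.conv c d)) (q.conv e f) * q.phi a b (q.conv c d))) := by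
        rw [nat₁, pent₁, ← mul_assoc (q.phiBar _ e f), nat₂]
        simp only [mul_assoc]
    _ = q.phi c d e * q.phi b (q.conv c d) e *
        (q.phiBar (q.conv b (q.conv c d)) e f * q.phiBar b (q.conv c d) (q.conv e f)) *
          (q.phi a b (q.conv (q.conv c d) (q.conv e f)) *
            q.phi (q.conv a b) (q.conv c d) (q.conv e f)) := by
        rw [inv₁, pent₂]
        simp only [mul_assoc, one_mul]
    _ = q.phi c d e * (q.phi b (q.conv c d) e * q.phiBar b (q.conv c d) e) *
          q.phiBar b (q.conv (q.conv c d) e) f *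
          ((q.phiBar (q.conv c d) e f * q.phi a b (q.conv (q.conv c d) (q.conv e f))) *
            q.phi (q.conv a b) (q.conv c d) (q.conv e f)) := by
        rw [pent₃]
        simp only [mul_assoc]
    _ = (q.phiBar b (q.conv c (q.conv d e)) f * q.phi c d e) *
          ((q.phi a b (q.conv (q.conv (q.conv c d) e) f) * q.phiBar (q.conv c d) e f) *
            q.phi (q.conv a b) (q.conv c d) (q.conv e f)) := by
        rw [inv₂, mul_one, ← nat₄, nat₅]
    _ = q.phiBar b (q.conv c (q.conv d e)) f * (q.phi c d e *
          q.phi a b (q.conv (q.conv (q.conv c d) e) f)) * (q.phiBar (q.conv c d) e f *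
            q.phi (q.conv a b) (q.conv c d) (q.conv e f)) := by
        simp only [mul_assoc]
    _ = _ := by
        rw [← nat₃]
        simp only [mul_assoc]

end Coherence

section Adjoint

variable {k H V W : Type} [Field k] [Ring H] [Algebra k H] [AddCommGroup V] [Module k V]
  [AddCommGroup W] [Module k W] (q : QuasiHopf k H)

/-- The action of `H` on `V ⊗ W` through the left factor. -/
def onLeft (W : Type) [AddCommGroup W] [Module k W] (f : H →ₐ[k] Module.End k V) :
    H →ₐ[k] Module.End k (V ⊗[k] W) :=
  (Module.End.rTensorAlgHom k V W).comp f

/-- The action of `H` on `V ⊗ W` through the right factor. -/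
def onRight (V : Type) [AddCommGroup V] [Module k V] (g : H →ₐ[k] Module.End k W) :
    H →ₐ[k] Module.End k (V ⊗[k] W) :=
  (Module.End.lTensorAlgHom k W V).comp g

@[simp]
theorem onLeft_tmul (f : H →ₐ[k] Module.End k V) (x : H) (v : V) (w : W) :
    onLeft W f x (v ⊗ₜ w) = f x v ⊗ₜ w :=
  rfl

@[simp]
theorem onRight_tmul (g : H →ₐ[k] Module.End k W) (x : H) (v : V) (w : W) :
    onRight V g x (v ⊗ₜ w) = v ⊗ₜ g x w :=
  rfl

instance onLeft_onLeft (f g : H →ₐ[k] Module.End k V) [CommutingMaps f g] :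
    CommutingMaps (onLeft W f) (onLeft W g) where
  commute x y := (commute x y).map (Module.End.rTensorAlgHom k V W)

instance onRight_onRight (f g : H →ₐ[k] Module.End k W) [CommutingMaps f g] :
    CommutingMaps (onRight V f) (onRight V g) where
  commute x y := (commute x y).map (Module.End.lTensorAlgHom k W V)

instance onLeft_onRight (f : H →ₐ[k] Module.End k V) (g : H →ₐ[k] Module.End k W) :
    CommutingMaps (onLeft W f) (onRight V g) where
  commute _ _ := TensorProduct.ext' fun _ _ => rfl

/-- The action `x · a = a S(x)` of `H` on itself. -/
def antipodeAct : H →ₐ[k] Module.End k H :=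
  .ofLinearMap ((LinearMap.mul k H).flip ∘ₗ q.S) (by ext; simp [q.S_one])
    (fun x y => by ext; simp [q.S_mul, mul_assoc])

@[simp]
theorem antipodeAct_apply (x a : H) : q.antipodeAct x a = a * q.S x :=
  rfl

instance lmul_antipodeAct : CommutingMaps (Algebra.lmul k H) q.antipodeAct where
  commute x y := LinearMap.ext fun a => (mul_assoc x a (q.S y)).symm

theorem conv_lmul_antipodeAct (x a : H) :
    q.conv (Algebra.lmul k H) q.antipodeAct x a = q.ad x a := by
  simp [conv_apply, LinearMap.sum_apply, ad, mul_assoc]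

/-- The contraction `a ⊗ b ↦ a α b`. -/
def contract : H ⊗[k] H →ₗ[k] H :=
  TensorProduct.lift ((LinearMap.mul k H) ∘ₗ (LinearMap.mul k H).flip q.alpha)

@[simp]
theorem contract_tmul (a b : H) : q.contract (a ⊗ₜ b) = a * q.alpha * b :=
  rfl

/-- The contraction `a ⊗ b ⊗ c ↦ a α b ⊗ c`. -/
def contractLeft : H ⊗[k] (H ⊗[k] H) →ₗ[k] H ⊗[k] H :=
  q.contract.rTensor H ∘ₗ (TensorProduct.assoc k H H H).symm.toLinearMap

/-- The contraction `a ⊗ b ⊗ c ↦ a ⊗ b α c`. -/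
def contractRight : H ⊗[k] (H ⊗[k] H) →ₗ[k] H ⊗[k] H :=
  q.contract.lTensor H

@[simp]
theorem contractLeft_tmul (a b c : H) :
    q.contractLeft (a ⊗ₜ (b ⊗ₜ c)) = (a * q.alpha * b) ⊗ₜ c :=
  rfl

@[simp]
theorem contractRight_tmul (a : H) (w : H ⊗[k] H) :
    q.contractRight (a ⊗ₜ w) = a ⊗ₜ q.contract w :=
  rfl

theorem contract_contractLeft (v : H ⊗[k] (H ⊗[k] H)) :
    q.contract (q.contractLeft v) = q.contract (q.contractRight v) := by
  refine LinearMap.congr_fun (f := q.contract ∘ₗ q.contractLeft)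
    (g := q.contract ∘ₗ q.contractRight)
    (TensorProduct.ext (LinearMap.ext fun a => TensorProduct.ext' fun b c => ?_)) v
  simp [mul_assoc]

theorem mul_antipode_alpha_mul (x a b : H) :
    ∑ i ∈ Finset.range (q.n x), a * q.S (q.d1 x i) * q.alpha * (q.d2 x i * b) =
      q.counit x • (a * q.alpha * b) := by
  calc _ = a * (∑ i ∈ Finset.range (q.n x), q.S (q.d1 x i) * q.alpha * q.d2 x i) * b := by
        simp only [Finset.mul_sum, Finset.sum_mul, mul_assoc]
    _ = _ := by rw [q.antipode_alpha]; simp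

local notation "ℓ₁" => onLeft H (Algebra.lmul k H)
local notation "ρ₁" => onLeft H (antipodeAct q)
local notation "ℓ₂" => onRight H (Algebra.lmul k H)
local notation "ρ₂" => onRight H (antipodeAct q)
local notation "μ₁" => onLeft (H ⊗[k] H) (Algebra.lmul k H)
local notation "σ₁" => onLeft (H ⊗[k] H) (antipodeAct q)
local notation "μ₂" => onRight H ℓ₁
local notation "σ₂" => onRight H ρ₁
local notation "μ₃" => onRight H ℓ₂
local notation "σ₃" => onRight H ρ₂

theorem star_eq (a b : H) :
    q.star a b = q.contract (q.reassoc ℓ₁ ρ₁ ℓ₂ ρ₂ (a ⊗ₜ b)) := by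
  simp only [star, reassoc, phi_eq_sum, phiBar_eq_sum, conv_apply, Finset.sum_mul,
    Finset.mul_sum, LinearMap.sum_apply, Module.End.mul_apply, onLeft_tmul, onRight_tmul,
    map_sum, contract_tmul, antipodeAct_apply, q.S_mul, mul_assoc, Algebra.coe_lmul_eq_mul,
    LinearMap.mul_apply']
  exact Finset.sum_congr rfl fun _ _ => Finset.sum_comm

theorem contract_conv :
    Intertwines q.contract (q.conv ρ₁ ℓ₂) (q.counitMap (Module.End k H)) :=
  .of_tmul fun x a b => by
    simpa [conv_apply, LinearMap.sum_apply, counitMap_apply] using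
      q.mul_antipode_alpha_mul x a b

theorem contract_left : Intertwines q.contract ℓ₁ (Algebra.lmul k H) :=
  .of_tmul fun x a b => by simp [mul_assoc]

theorem contract_right : Intertwines q.contract ρ₂ q.antipodeAct :=
  .of_tmul fun x a b => by simp [mul_assoc]

theorem contract_reassoc (v : H ⊗[k] H) :
    q.contract (q.reassoc ℓ₁ ρ₁ ℓ₂ ρ₂ v) = q.contract (q.reassoc' ℓ₁ ρ₁ ℓ₂ ρ₂ v) := by
  rw [reassoc_eq, Module.End.mul_apply,
    q.contract_left.phi q q.contract_conv q.contract_right, phi_counit_middle,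
    Module.End.one_apply]

theorem contractLeft_conv :
    Intertwines q.contractLeft (q.conv σ₁ μ₂) (q.counitMap _) :=
  .of_tmul_tmul fun x a b c => by
    simpa [conv_apply, LinearMap.sum_apply, counitMap_apply,
      TensorProduct.sum_tmul, TensorProduct.smul_tmul'] using
      congrArg (· ⊗ₜ[k] c) (q.mul_antipode_alpha_mul x a b)

theorem contractLeft_left : Intertwines q.contractLeft μ₁ ℓ₁ :=
  .of_tmul_tmul fun x a b c => by simp [mul_assoc]

theorem contractLeft_antipode : Intertwines q.contractLeft σ₂ ρ₁ :=
  .of_tmul_tmul fun x a b c => by simp [mul_assoc]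

theorem contractLeft_lmul_right : Intertwines q.contractLeft μ₃ ℓ₂ :=
  .of_tmul_tmul fun x a b c => by simp

theorem contractLeft_antipode_right : Intertwines q.contractLeft σ₃ ρ₂ :=
  .of_tmul_tmul fun x a b c => by simp

theorem contractRight_conv :
    Intertwines q.contractRight (q.conv σ₂ μ₃) (q.counitMap _) :=
  .of_tmul_tmul fun x a b c => by
    simpa [conv_apply, LinearMap.sum_apply, counitMap_apply,
      TensorProduct.tmul_sum] using
      congrArg (a ⊗ₜ[k] ·) (q.mul_antipode_alpha_mul x b c)

theorem contractRight_lmul_left : Intertwines q.contractRight μ₁ ℓ₁ :=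
  .of_tmul_tmul fun x a b c => by simp

theorem contractRight_antipode_left : Intertwines q.contractRight σ₁ ρ₁ :=
  .of_tmul_tmul fun x a b c => by simp

theorem contractRight_lmul : Intertwines q.contractRight μ₂ ℓ₂ :=
  .of_tmul_tmul fun x a b c => by simp [mul_assoc]

theorem contractRight_antipode : Intertwines q.contractRight σ₃ ρ₂ :=
  .of_tmul_tmul fun x a b c => by simp [mul_assoc]

theorem contractRight_reassoc (v : H ⊗[k] (H ⊗[k] H)) :
    q.contractRight (q.reassoc μ₂ σ₂ μ₃ σ₃ v) = q.contractRight (q.reassoc' μ₂ σ₂ μ₃ σ₃ v) := by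
  rw [reassoc_eq, Module.End.mul_apply,
    q.contractRight_lmul.phi q q.contractRight_conv q.contractRight_antipode,
    phi_counit_middle, Module.End.one_apply]

theorem tmul_star (a b c : H) :
    a ⊗ₜ[k] q.star b c = q.contractRight (q.reassoc μ₂ σ₂ μ₃ σ₃ (a ⊗ₜ (b ⊗ₜ c))) := by
  have key := Intertwines.reassoc q (T := TensorProduct.mk k H (H ⊗[k] H) a)
    (f := ℓ₁) (g := ρ₁) (h := ℓ₂) (l := ρ₂) (f' := μ₂) (g' := σ₂) (h' := μ₃) (l' := σ₃)
    (fun _ _ => rfl) (fun _ _ => rfl) (fun _ _ => rfl) (fun _ _ => rfl) (b ⊗ₜ c)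
  rw [TensorProduct.mk_apply, TensorProduct.mk_apply] at key
  rw [← key, contractRight_tmul, star_eq]

theorem star_tmul (a b c : H) :
    q.star a b ⊗ₜ[k] c = q.contractLeft (q.reassoc μ₁ σ₁ μ₂ σ₂ (a ⊗ₜ (b ⊗ₜ c))) := by
  let T : H ⊗[k] H →ₗ[k] H ⊗[k] (H ⊗[k] H) := ((TensorProduct.mk k H H).flip c).lTensor H
  have key := Intertwines.reassoc q (T := T)
    (f := ℓ₁) (g := ρ₁) (h := ℓ₂) (l := ρ₂) (f' := μ₁) (g' := σ₁) (h' := μ₂) (l' := σ₂)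
    (.of_tmul fun _ _ _ => rfl) (.of_tmul fun _ _ _ => rfl) (.of_tmul fun _ _ _ => rfl)
    (.of_tmul fun _ _ _ => rfl) (a ⊗ₜ b)
  have hT (w : H ⊗[k] H) : q.contractLeft (T w) = q.contract w ⊗ₜ c :=
    LinearMap.congr_fun (f := q.contractLeft ∘ₗ T)
      (g := (TensorProduct.mk k H H).flip c ∘ₗ q.contract) (TensorProduct.ext' fun _ _ => rfl) w
  rw [star_eq, ← hT, key]
  rfl

theorem star_beta (a : H) : q.star a q.beta = a := by
  let T : H →ₗ[k] H ⊗[k] H := (TensorProduct.mk k H H).flip q.beta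
  have hT : Intertwines T (q.counitMap (Module.End k H)) (q.conv ℓ₂ ρ₂) := fun x v => by
    have := congrArg (v ⊗ₜ[k] ·) (q.antipode_beta x)
    simpa [T, conv_apply, LinearMap.sum_apply, counitMap_apply,
      TensorProduct.tmul_sum, mul_assoc] using this.symm
  have key := Intertwines.phi q (T := T) (f := Algebra.lmul k H) (g := q.antipodeAct)
    (f' := ℓ₁) (g' := ρ₁) (fun _ _ => rfl) (fun _ _ => rfl) hT a
  rw [phi_counit_right, Module.End.one_apply] at key
  change a ⊗ₜ q.beta = q.phi ℓ₁ ρ₁ (q.conv ℓ₂ ρ₂) (a ⊗ₜ q.beta) at key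
  rw [star_eq, reassoc, Module.End.mul_apply, ← key]
  simpa [phiBar_eq_sum, LinearMap.sum_apply, Finset.mul_sum, mul_assoc] using
    congrArg (a * ·) q.nondeg_2

theorem beta_star (a : H) : q.star q.beta a = a := by
  let T : H →ₗ[k] H ⊗[k] H := TensorProduct.mk k H H q.beta
  have hT : Intertwines T (q.counitMap (Module.End k H)) (q.conv ℓ₁ ρ₁) := fun x v => by
    have := congrArg (· ⊗ₜ[k] v) (q.antipode_beta x)
    simpa [T, conv_apply, LinearMap.sum_apply, counitMap_apply,
      TensorProduct.sum_tmul, TensorProduct.smul_tmul', mul_assoc] using this.symm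
  have key := Intertwines.phiBar q (T := T) (g := Algebra.lmul k H) (h := q.antipodeAct)
    (g' := ℓ₂) (h' := ρ₂) hT (fun _ _ => rfl) (fun _ _ => rfl) a
  rw [phiBar_counit_left, Module.End.one_apply] at key
  change q.beta ⊗ₜ a = q.phiBar (q.conv ℓ₁ ρ₁) ℓ₂ ρ₂ (q.beta ⊗ₜ a) at key
  rw [star_eq, contract_reassoc, reassoc', Module.End.mul_apply, ← key]
  simpa [phi_eq_sum, LinearMap.sum_apply, Finset.sum_mul, mul_assoc] using
    congrArg (· * a) q.nondeg_1

theorem ad_beta (x : H) : q.ad x q.beta = q.counit x • q.beta :=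
  q.antipode_beta x

theorem ad_star (x a b : H) : q.ad x (q.star a b) =
    ∑ i ∈ Finset.range (q.n x), q.star (q.ad (q.d1 x i) a) (q.ad (q.d2 x i) b) := by
  have hL : ∀ y c d, q.conv ℓ₁ ρ₁ y (c ⊗ₜ d) = q.ad y c ⊗ₜ[k] d := fun y c d => by
    simp [conv_apply, LinearMap.sum_apply, ad, TensorProduct.sum_tmul,
      mul_assoc]
  have hR : ∀ y c d, q.conv ℓ₂ ρ₂ y (c ⊗ₜ d) = c ⊗ₜ[k] q.ad y d := fun y c d => by
    simp [conv_apply, LinearMap.sum_apply, ad, TensorProduct.tmul_sum,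
      mul_assoc]
  have nat : q.reassoc ℓ₁ ρ₁ ℓ₂ ρ₂ * q.conv (q.conv ℓ₁ ρ₁) (q.conv ℓ₂ ρ₂) x =
      q.conv ℓ₁ (q.conv (q.conv ρ₁ ℓ₂) ρ₂) x * q.reassoc ℓ₁ ρ₁ ℓ₂ ρ₂ := by
    rw [reassoc, mul_assoc, phi_mul_conv, ← mul_assoc, ← mul_assoc]
    congr 1
    exact LinearMap.ext ((q.intertwines_phiBar_left ℓ₁ ρ₁ ℓ₂ ρ₂).conv q
      (q.intertwines_phiBar_conv ρ₁ ℓ₂ ρ₂) x)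
  have key := congrArg q.contract (LinearMap.congr_fun nat (a ⊗ₜ b))
  rw [Module.End.mul_apply, Module.End.mul_apply,
    q.contract_left.conv q (q.contract_conv.conv_counit_left q q.contract_right), ← star_eq,
    conv_lmul_antipodeAct] at key
  rw [← key, conv_apply]
  simp only [LinearMap.sum_apply, Module.End.mul_apply, hL, hR, map_sum, star_eq]

theorem phi_conv_tmul (a b c : H) :
    q.phi (q.conv μ₁ σ₁) (q.conv μ₂ σ₂) (q.conv μ₃ σ₃) (a ⊗ₜ (b ⊗ₜ c)) =
      ∑ e ∈ Finset.range q.np,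
        q.ad (q.P1 e) a ⊗ₜ (q.ad (q.P2 e) b ⊗ₜ[k] q.ad (q.P3 e) c) := by
  have h₁ : ∀ y a b c, q.conv μ₁ σ₁ y (a ⊗ₜ (b ⊗ₜ c)) = q.ad y a ⊗ₜ[k] (b ⊗ₜ[k] c) :=
    fun y a b c => by
      simp [conv_apply, LinearMap.sum_apply, ad, TensorProduct.sum_tmul,
        mul_assoc]
  have h₂ : ∀ y a b c, q.conv μ₂ σ₂ y (a ⊗ₜ (b ⊗ₜ c)) = a ⊗ₜ[k] (q.ad y b ⊗ₜ[k] c) :=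
    fun y a b c => by
      simp [conv_apply, LinearMap.sum_apply, ad, TensorProduct.sum_tmul,
        TensorProduct.tmul_sum, mul_assoc]
  have h₃ : ∀ y a b c, q.conv μ₃ σ₃ y (a ⊗ₜ (b ⊗ₜ c)) = a ⊗ₜ[k] (b ⊗ₜ[k] q.ad y c) :=
    fun y a b c => by
      simp [conv_apply, LinearMap.sum_apply, ad, TensorProduct.tmul_sum,
        mul_assoc]
  simp [phi_eq_sum, LinearMap.sum_apply, h₁, h₂, h₃]

theorem star_assoc (a b c : H) : q.star (q.star a b) c =
    ∑ e ∈ Finset.range q.np,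
      q.star (q.ad (q.P1 e) a) (q.star (q.ad (q.P2 e) b) (q.ad (q.P3 e) c)) := by
  have coh := congrArg (fun u => q.contract (q.contractRight (u (a ⊗ₜ (b ⊗ₜ c)))))
    (q.reassoc_coherence μ₁ σ₁ μ₂ σ₂ μ₃ σ₃)
  simp only [Module.End.mul_apply] at coh
  rw [q.contractRight_antipode_left.phi q q.contractRight_lmul q.contractRight_conv,
    phi_counit_right, Module.End.one_apply, ← contract_contractLeft,
    q.contractLeft_conv.phi q q.contractLeft_antipode q.contractLeft_lmul_right,
    phi_counit_left, Module.End.one_apply,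
    q.contractLeft_left.reassoc q
      (q.contractLeft_conv.conv_counit_left q q.contractLeft_antipode)
      q.contractLeft_lmul_right q.contractLeft_antipode_right,
    q.contractRight_lmul_left.reassoc q q.contractRight_antipode_left
      (q.contractRight_lmul.conv_counit_right q q.contractRight_conv) q.contractRight_antipode,
    ← contractRight_reassoc, phi_conv_tmul, ← star_tmul, ← star_eq] at coh
  rw [coh]
  simp only [map_sum, ← tmul_star, ← star_eq]

end Adjoint

end QuasiHopf

/-- `(H, ⋆, β)` with the adjoint action is an algebra in the
monoidal category of left `H`-modules:  `β` is a two-sided unit for `⋆`, `⋆` is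
associative up to the associator, and `⋆` and `β` are `H`-linear. -/
theorem statement14 (k H : Type) [Field k] [Ring H] [Algebra k H] (q : QuasiHopf k H) :
    (∀ a : H, q.star q.beta a = a ∧ q.star a q.beta = a) ∧
    (∀ a b c : H, q.star (q.star a b) c =
      ∑ e ∈ Finset.range q.np,
        q.star (q.ad (q.P1 e) a) (q.star (q.ad (q.P2 e) b) (q.ad (q.P3 e) c))) ∧
    (∀ h a b : H, q.ad h (q.star a b) =
      ∑ i ∈ Finset.range (q.n h), q.star (q.ad (q.d1 h i) a) (q.ad (q.d2 h i) b)) ∧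
    (∀ h : H, q.ad h q.beta = q.counit h • q.beta) := by
  exact ⟨fun a => ⟨q.beta_star a, q.star_beta a⟩, q.star_assoc, q.ad_star, q.ad_beta⟩
end
end
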